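/- arXiv:1311.0355 — 5 statements merged into one kernel-verified Lean document; each statement's English description precedes it below -/
import Mathlib

section
/- Suppose the weight function w is symmetric and x is a solution of the opinion dynamics. Then ∫_0^∞ ∫_0^1 ∫_0^1 w(t,α,β,x_t(α),x_t(β)) · (x_t(β) − x_t(α))² dα dβ dt < ∞. -/
open MeasureTheory Filter Set Topology

/-- The interaction field at time `t` for agent `α`:
`∫_0^1 w(t,α,β,x_t(α),x_t(β)) · (x_t(β) − x_t(α)) dβ`. -/
noncomputable def interactionField (w : ℝ → ℝ → ℝ → ℝ → ℝ → ℝ) (x : ℝ → ℝ → ℝ)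
    (t α : ℝ) : ℝ :=
  ∫ β in (0:ℝ)..1, w t α β (x t α) (x t β) * (x t β - x t α)

/-- `f` is absolutely continuous on the compact interval `[a,b]`. -/
def AbsolutelyContinuousOn (f : ℝ → ℝ) (a b : ℝ) : Prop :=
  ∀ ε > 0, ∃ δ > 0, ∀ n : ℕ, ∀ c d : Fin n → ℝ,
    (∀ i, a ≤ c i ∧ c i ≤ d i ∧ d i ≤ b) →
    (Pairwise fun i j => Set.Ioo (c i) (d i) ∩ Set.Ioo (c j) (d j) = ∅) →
    (∑ i, (d i - c i)) < δ → (∑ i, |f (d i) - f (c i)|) < ε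

/-- `w` is an admissible weight function: jointly Borel measurable, nonnegative and
bounded by `W` on the domain `[0,∞) × [0,1] × [0,1] × ℝ × ℝ`. -/
structure IsWeight (W : ℝ) (w : ℝ → ℝ → ℝ → ℝ → ℝ → ℝ) : Prop where
  measurable : Measurable fun p : ℝ × ℝ × ℝ × ℝ × ℝ =>
    w p.1 p.2.1 p.2.2.1 p.2.2.2.1 p.2.2.2.2
  nonneg : ∀ t, 0 ≤ t → ∀ α ∈ Icc (0:ℝ) 1, ∀ β ∈ Icc (0:ℝ) 1, ∀ a b : ℝ,
    0 ≤ w t α β a b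
  le_bound : ∀ t, 0 ≤ t → ∀ α ∈ Icc (0:ℝ) 1, ∀ β ∈ Icc (0:ℝ) 1, ∀ a b : ℝ,
    w t α β a b ≤ W

/-- `x` is a solution of the opinion dynamics with weight function `w`:
measurable in the agent, absolutely continuous in time on compact intervals,
with initial opinions in `[0,1]`, locally bounded, and for each agent satisfying
the ODE `(d/dt) x_t(α) = ∫_0^1 w(t,α,β,x_t(α),x_t(β))·(x_t(β) − x_t(α)) dβ`
for almost every `t ≥ 0`. -/
structure IsSolution (w : ℝ → ℝ → ℝ → ℝ → ℝ → ℝ) (x : ℝ → ℝ → ℝ) : Prop where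
  meas : ∀ t, 0 ≤ t → Measurable (x t)
  absCont : ∀ α ∈ Icc (0:ℝ) 1, ∀ T, 0 ≤ T → AbsolutelyContinuousOn (fun t => x t α) 0 T
  init_mem : ∀ α ∈ Icc (0:ℝ) 1, x 0 α ∈ Icc (0:ℝ) 1
  locBdd : ∀ T, 0 ≤ T → ∃ M : ℝ, ∀ α ∈ Icc (0:ℝ) 1, ∀ t ∈ Icc (0:ℝ) T, |x t α| ≤ M
  ode : ∀ α ∈ Icc (0:ℝ) 1, ∀ᵐ t ∂(volume.restrict (Ici (0:ℝ))),
    HasDerivAt (fun s => x s α) (interactionField w x t α) t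

/-- The weight function is symmetric. -/
def SymmetricWeight (w : ℝ → ℝ → ℝ → ℝ → ℝ → ℝ) : Prop :=
  ∀ t α β a b, w t α β a b = w t β α b a

/-- `w ∈ Γ(r,Δ)`: the weight is at least `Δ` whenever the two opinions are within `r`. -/
def InGamma (r Δ : ℝ) (w : ℝ → ℝ → ℝ → ℝ → ℝ → ℝ) : Prop :=
  ∀ t, 0 ≤ t → ∀ α ∈ Icc (0:ℝ) 1, ∀ β ∈ Icc (0:ℝ) 1, ∀ a b : ℝ,
    |a - b| ≤ r → Δ ≤ w t α β a b

/-- The opinion distribution `μ_t`: pushforward of Lebesgue measure on `[0,1]` by `x_t`. -/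
noncomputable def opinionMeasure (x : ℝ → ℝ → ℝ) (t : ℝ) : Measure ℝ :=
  (volume.restrict (Icc (0:ℝ) 1)).map (x t)

/-- The order of the opinions is preserved: if agent `β`'s opinion is strictly above
agent `α`'s at some time, it is strictly above at every time. -/
def OrderPreserved (x : ℝ → ℝ → ℝ) : Prop :=
  ∀ α ∈ Icc (0:ℝ) 1, ∀ β ∈ Icc (0:ℝ) 1, ∀ s, 0 ≤ s → ∀ t, 0 ≤ t →
    x t α < x t β → x s α < x s β

theorem AbsolutelyContinuousOn.absolutelyContinuousOnInterval {f : ℝ → ℝ} {a b : ℝ} (hab : a ≤ b)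
    (hf : AbsolutelyContinuousOn f a b) : AbsolutelyContinuousOnInterval f a b := by
  rw [absolutelyContinuousOnInterval_iff]
  intro ε hε
  obtain ⟨δ, hδ, h⟩ := hf ε hε
  refine ⟨δ, hδ, fun E hE hlen => ?_⟩
  obtain ⟨hmem, hdisj⟩ := hE
  have key := h E.1 (fun i => min (E.2 i).1 (E.2 i).2) (fun i => max (E.2 i).1 (E.2 i).2)
    (fun i => by
      have hi := hmem i (Finset.mem_range.2 i.2)
      rw [uIcc_of_le hab] at hi
      exact ⟨le_min hi.1.1 hi.2.1, min_le_max, max_le hi.1.2 hi.2.2⟩)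
    (fun i j hij => by
      have := hdisj (Finset.mem_coe.2 (Finset.mem_range.2 i.2))
        (Finset.mem_coe.2 (Finset.mem_range.2 j.2)) (fun hh => hij (Fin.ext hh))
      exact disjoint_iff_inter_eq_empty.1 (this.mono Ioo_subset_Ioc_self Ioo_subset_Ioc_self))
    (by
      rw [Finset.sum_range] at hlen
      simpa only [max_sub_min_eq_abs', Real.dist_eq] using hlen)
  rw [Finset.sum_range]
  refine lt_of_le_of_lt (Finset.sum_le_sum fun i _ => ?_) key
  rcases le_total (E.2 i).1 (E.2 i).2 with hi | hi
  · simp only [min_eq_left hi, max_eq_right hi, Real.dist_eq]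
    rw [abs_sub_comm]
  · simp only [min_eq_right hi, max_eq_left hi, Real.dist_eq, le_refl]

theorem AbsolutelyContinuousOnInterval.integral_two_mul_mul_eq_sq_sub_sq {f g : ℝ → ℝ} {a b : ℝ}
    (hf : AbsolutelyContinuousOnInterval f a b)
    (hg : ∀ᵐ t, t ∈ uIoc a b → HasDerivAt f (g t) t) :
    ∫ t in a..b, 2 * f t * g t = f b ^ 2 - f a ^ 2 := by
  have h := (hf.fun_mul hf).integral_deriv_eq_sub
  rw [sq, sq, ← h]
  refine intervalIntegral.integral_congr_ae ?_
  filter_upwards [hg] with t ht hmem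
  rw [((ht hmem).fun_mul (ht hmem)).deriv]
  ring

/-- Symmetrization of a quadratic interaction energy. -/
theorem integral_two_mul_symm_kernel_eq_neg {Ω : Type*} [MeasurableSpace Ω] {μ : Measure Ω}
    [SFinite μ] {k : Ω → Ω → ℝ} {f : Ω → ℝ} (hk : ∀ a b, k a b = k b a)
    (hint : Integrable (fun p : Ω × Ω => 2 * f p.1 * (k p.1 p.2 * (f p.2 - f p.1)))
      (μ.prod μ)) :
    ∫ p : Ω × Ω, 2 * f p.1 * (k p.1 p.2 * (f p.2 - f p.1)) ∂(μ.prod μ) =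
      -∫ p : Ω × Ω, k p.1 p.2 * (f p.2 - f p.1) ^ 2 ∂(μ.prod μ) := by
  have hswap := integral_prod_swap (μ := μ) (ν := μ)
    (fun p : Ω × Ω => 2 * f p.1 * (k p.1 p.2 * (f p.2 - f p.1)))
  have hadd := integral_add hint hint.swap
  simp only [Function.comp_apply, Prod.fst_swap, Prod.snd_swap] at hswap hadd
  rw [hswap] at hadd
  have heq : ∫ p : Ω × Ω, (2 * f p.1 * (k p.1 p.2 * (f p.2 - f p.1)) +
      2 * f p.2 * (k p.2 p.1 * (f p.1 - f p.2))) ∂(μ.prod μ) =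
      -2 * ∫ p : Ω × Ω, k p.1 p.2 * (f p.2 - f p.1) ^ 2 ∂(μ.prod μ) := by
    rw [← integral_const_mul]
    refine integral_congr_ae (Eventually.of_forall fun p => ?_)
    simp only [hk p.2 p.1]
    ring
  linarith

/-- The opinion trajectories, frozen at negative times and set to zero outside `[0,1]`. -/
noncomputable def extendedOpinion (x : ℝ → ℝ → ℝ) (t α : ℝ) : ℝ :=
  (Icc (0:ℝ) 1).indicator (x (max t 0)) α

theorem extendedOpinion_eq (x : ℝ → ℝ → ℝ) {t α : ℝ} (ht : 0 ≤ t) (hα : α ∈ Icc (0:ℝ) 1) :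
    extendedOpinion x t α = x t α := by
  simp [extendedOpinion, indicator_of_mem hα, max_eq_left ht]

namespace IsSolution

variable {w : ℝ → ℝ → ℝ → ℝ → ℝ → ℝ} {x : ℝ → ℝ → ℝ}

theorem absolutelyContinuousOnInterval (hx : IsSolution w x) {α T : ℝ} (hα : α ∈ Icc (0:ℝ) 1)
    (hT : 0 ≤ T) : AbsolutelyContinuousOnInterval (fun t => x t α) 0 T :=
  (hx.absCont α hα T hT).absolutelyContinuousOnInterval hT

theorem continuousOn (hx : IsSolution w x) {α : ℝ} (hα : α ∈ Icc (0:ℝ) 1) :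
    ContinuousOn (fun t => x t α) (Ici 0) := by
  intro t ht
  have h := (hx.absolutelyContinuousOnInterval hα
    (add_nonneg (mem_Ici.1 ht) zero_le_one)).continuousOn
  have ht' : t < t + 1 := lt_add_one t
  rw [uIcc_of_le (add_nonneg (mem_Ici.1 ht) zero_le_one)] at h
  refine (h t ⟨ht, ht'.le⟩).mono_of_mem_nhdsWithin ?_
  filter_upwards [self_mem_nhdsWithin, mem_nhdsWithin_of_mem_nhds (Iio_mem_nhds ht')] with s hs hs'
  exact ⟨hs, le_of_lt hs'⟩

theorem measurable_uncurry_extendedOpinion (hx : IsSolution w x) :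
    Measurable (Function.uncurry (extendedOpinion x)) := by
  refine measurable_uncurry_of_continuous_of_measurable (fun α => ?_) (fun t => ?_)
  · by_cases hα : α ∈ Icc (0:ℝ) 1
    · simp only [extendedOpinion, indicator_of_mem hα]
      exact (hx.continuousOn hα).comp_continuous (continuous_id.max continuous_const)
        (fun t => le_max_right t 0)
    · simp only [extendedOpinion, indicator_of_notMem hα]
      exact continuous_const
  · exact (hx.meas _ (le_max_right t 0)).indicator measurableSet_Icc

theorem ae_hasDerivAt (hx : IsSolution w x) {α : ℝ} (hα : α ∈ Icc (0:ℝ) 1) (T : ℝ) :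
    ∀ᵐ t, t ∈ Ioc 0 T → HasDerivAt (fun s => x s α) (interactionField w x t α) t := by
  have h := hx.ode α hα
  rw [ae_restrict_iff' measurableSet_Ici] at h
  filter_upwards [h] with t ht hmem using ht hmem.1.le

end IsSolution

/-- The dissipation over a bounded time interval is at most the initial energy. -/
theorem lintegral_dissipation_Ioc_le_one {W : ℝ} {w : ℝ → ℝ → ℝ → ℝ → ℝ → ℝ} {x : ℝ → ℝ → ℝ}
    (hw : IsWeight W w) (hsym : SymmetricWeight w) (hx : IsSolution w x) {T : ℝ} (hT : 0 ≤ T) :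
    (∫⁻ t in Ioc (0:ℝ) T, ∫⁻ β in Icc (0:ℝ) 1, ∫⁻ α in Icc (0:ℝ) 1,
      ENNReal.ofReal (w t α β (x t α) (x t β) * (x t β - x t α) ^ 2)) ≤ 1 := by
  obtain ⟨M, hM⟩ := hx.locBdd T hT
  set μ : Measure ℝ := volume.restrict (Icc (0:ℝ) 1) with hμ
  set τ : Measure ℝ := volume.restrict (Ioc (0:ℝ) T) with hτ
  have : IsFiniteMeasure μ := ⟨by simp [hμ]⟩
  have : IsFiniteMeasure τ := ⟨by simp [hτ]⟩
  set y := extendedOpinion x with hy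
  have hyx : ∀ t ∈ Ioc (0:ℝ) T, ∀ α ∈ Icc (0:ℝ) 1, y t α = x t α := fun t ht α hα =>
    extendedOpinion_eq x ht.1.le hα
  have hym : Measurable (Function.uncurry y) := hx.measurable_uncurry_extendedOpinion
  have hyM : ∀ t ∈ Ioc (0:ℝ) T, ∀ α ∈ Icc (0:ℝ) 1, |y t α| ≤ M := fun t ht α hα => by
    rw [hyx t ht α hα]; exact hM α hα t ⟨ht.1.le, ht.2⟩
  set k : ℝ → ℝ → ℝ → ℝ := fun t α β => w t α β (y t α) (y t β) with hkdef
  have hym1 : Measurable fun p : ℝ × ℝ × ℝ => y p.1 p.2.1 :=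
    hym.comp (measurable_fst.prodMk (measurable_fst.comp measurable_snd))
  have hym2 : Measurable fun p : ℝ × ℝ × ℝ => y p.1 p.2.2 :=
    hym.comp (measurable_fst.prodMk (measurable_snd.comp measurable_snd))
  have hkm : Measurable fun p : ℝ × ℝ × ℝ => k p.1 p.2.1 p.2.2 :=
    hw.measurable.comp (measurable_fst.prodMk ((measurable_fst.comp measurable_snd).prodMk
      ((measurable_snd.comp measurable_snd).prodMk (hym1.prodMk hym2))))
  have hk0 : ∀ t ∈ Ioc (0:ℝ) T, ∀ α ∈ Icc (0:ℝ) 1, ∀ β ∈ Icc (0:ℝ) 1, 0 ≤ k t α β :=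
    fun t ht α hα β hβ => hw.nonneg t ht.1.le α hα β hβ _ _
  have hkW : ∀ t ∈ Ioc (0:ℝ) T, ∀ α ∈ Icc (0:ℝ) 1, ∀ β ∈ Icc (0:ℝ) 1, |k t α β| ≤ W :=
    fun t ht α hα β hβ => by
      rw [abs_of_nonneg (hk0 t ht α hα β hβ)]
      exact hw.le_bound t ht.1.le α hα β hβ _ _
  set Q : ℝ × ℝ × ℝ → ℝ := fun p =>
    2 * y p.1 p.2.1 * (k p.1 p.2.1 p.2.2 * (y p.1 p.2.2 - y p.1 p.2.1)) with hQ
  set D : ℝ × ℝ × ℝ → ℝ := fun p =>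
    k p.1 p.2.1 p.2.2 * (y p.1 p.2.2 - y p.1 p.2.1) ^ 2 with hD
  have hQm : Measurable Q := (hym1.const_mul 2).mul (hkm.mul (hym2.sub hym1))
  have hDm : Measurable D := hkm.mul ((hym2.sub hym1).pow_const 2)
  have hdiff : ∀ t ∈ Ioc (0:ℝ) T, ∀ α ∈ Icc (0:ℝ) 1, ∀ β ∈ Icc (0:ℝ) 1,
      |y t β - y t α| ≤ 2 * M := fun t ht α hα β hβ => by
    have h1 := hyM t ht α hα
    have h2 := hyM t ht β hβ
    rw [abs_le] at *
    constructor <;> linarith [h1.1, h1.2, h2.1, h2.2]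
  have hQb : ∀ t ∈ Ioc (0:ℝ) T, ∀ α ∈ Icc (0:ℝ) 1, ∀ β ∈ Icc (0:ℝ) 1,
      ‖Q (t, α, β)‖ ≤ 2 * M * (W * (2 * M)) := fun t ht α hα β hβ => by
    have h1 := hyM t ht α hα
    have h2 := hkW t ht α hα β hβ
    have h3 := hdiff t ht α hα β hβ
    have h4 : 0 ≤ M := (abs_nonneg _).trans h1
    have h5 : 0 ≤ W := (abs_nonneg _).trans h2
    simp only [hQ, Real.norm_eq_abs, abs_mul, abs_two]
    gcongr
  have hDb : ∀ t ∈ Ioc (0:ℝ) T, ∀ α ∈ Icc (0:ℝ) 1, ∀ β ∈ Icc (0:ℝ) 1,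
      ‖D (t, α, β)‖ ≤ W * (2 * M) ^ 2 := fun t ht α hα β hβ => by
    have h2 := hkW t ht α hα β hβ
    have h3 := hdiff t ht α hα β hβ
    have h5 : 0 ≤ W := (abs_nonneg _).trans h2
    simp only [hD, Real.norm_eq_abs, abs_mul, abs_pow]
    gcongr
  have hmem : ∀ᵐ p ∂(τ.prod (μ.prod μ)),
      p ∈ Ioc (0:ℝ) T ×ˢ (Icc (0:ℝ) 1 ×ˢ Icc (0:ℝ) 1) := by
    rw [hμ, hτ, Measure.prod_restrict, Measure.prod_restrict]
    exact ae_restrict_mem (measurableSet_Ioc.prod (measurableSet_Icc.prod measurableSet_Icc))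
  have hmem' : ∀ᵐ p ∂((τ.prod μ).prod μ),
      p ∈ (Ioc (0:ℝ) T ×ˢ Icc (0:ℝ) 1) ×ˢ Icc (0:ℝ) 1 := by
    rw [hμ, hτ, Measure.prod_restrict, Measure.prod_restrict]
    exact ae_restrict_mem ((measurableSet_Ioc.prod measurableSet_Icc).prod measurableSet_Icc)
  have hQi : Integrable Q (τ.prod (μ.prod μ)) :=
    .of_bound hQm.aestronglyMeasurable _ <| hmem.mono fun p hp =>
      hQb _ hp.1 _ hp.2.1 _ hp.2.2
  have hDi : Integrable D (τ.prod (μ.prod μ)) :=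
    .of_bound hDm.aestronglyMeasurable _ <| hmem.mono fun p hp =>
      hDb _ hp.1 _ hp.2.1 _ hp.2.2
  have hQi' : Integrable (fun p : (ℝ × ℝ) × ℝ => Q (p.1.1, p.1.2, p.2)) ((τ.prod μ).prod μ) :=
    .of_bound (hQm.comp ((measurable_fst.comp measurable_fst).prodMk
      ((measurable_snd.comp measurable_fst).prodMk measurable_snd))).aestronglyMeasurable _ <|
      hmem'.mono fun p hp => hQb _ hp.1.1 _ hp.1.2 _ hp.2
  have hQD : ∫ p, Q p ∂(τ.prod (μ.prod μ)) = -∫ p, D p ∂(τ.prod (μ.prod μ)) := by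
    rw [integral_prod _ hQi, integral_prod _ hDi, ← integral_neg]
    refine integral_congr_ae ?_
    filter_upwards [hQi.prod_right_ae] with t ht
    exact integral_two_mul_symm_kernel_eq_neg (k := k t) (f := y t)
      (fun α β => hsym t α β _ _) ht
  have hagent : ∀ α ∈ Icc (0:ℝ) 1,
      ∫ t, ∫ β, Q (t, α, β) ∂μ ∂τ = x T α ^ 2 - x 0 α ^ 2 := fun α hα => by
    have hder := hx.ae_hasDerivAt hα T
    rw [← uIoc_of_le hT] at hder
    rw [← (hx.absolutelyContinuousOnInterval hα hT).integral_two_mul_mul_eq_sq_sub_sq hder,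
      intervalIntegral.integral_of_le hT]
    refine setIntegral_congr_fun measurableSet_Ioc fun t ht => ?_
    simp only [hQ, integral_const_mul, hyx t ht α hα]
    congr 1
    rw [interactionField, intervalIntegral.integral_of_le zero_le_one,
      ← integral_Icc_eq_integral_Ioc]
    refine setIntegral_congr_fun measurableSet_Icc fun β hβ => ?_
    simp only [hkdef, hyx t ht α hα, hyx t ht β hβ]
  have hQge : -1 ≤ ∫ p, Q p ∂(τ.prod (μ.prod μ)) := by
    have h1 : ∫ p, Q p ∂(τ.prod (μ.prod μ)) = ∫ t, ∫ α, ∫ β, Q (t, α, β) ∂μ ∂μ ∂τ := by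
      rw [integral_prod _ hQi]
      refine integral_congr_ae ?_
      filter_upwards [hQi.prod_right_ae] with t ht
      exact integral_prod _ ht
    have h2 : Integrable (Function.uncurry fun t α => ∫ β, Q (t, α, β) ∂μ) (τ.prod μ) :=
      hQi'.integral_prod_left
    rw [h1, integral_integral_swap h2]
    have h3 : ∫ _ : ℝ, (-1 : ℝ) ∂μ = -1 := by simp [hμ]
    rw [← h3]
    refine setIntegral_mono_on (integrable_const _) h2.integral_prod_right measurableSet_Icc
      fun α hα => ?_
    simp only [hagent α hα]
    have h4 := hx.init_mem α hα
    nlinarith [sq_nonneg (x T α), h4.1, h4.2]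
  have hD0 : 0 ≤ᵐ[τ.prod (μ.prod μ)] D := hmem.mono fun p hp =>
    mul_nonneg (hk0 _ hp.1 _ hp.2.1 _ hp.2.2) (sq_nonneg _)
  calc
    _ = ∫⁻ t, ∫⁻ β, ∫⁻ α, ENNReal.ofReal (D (t, α, β)) ∂μ ∂μ ∂τ := by
      refine setLIntegral_congr_fun measurableSet_Ioc fun t ht => ?_
      refine setLIntegral_congr_fun measurableSet_Icc fun β hβ => ?_
      refine setLIntegral_congr_fun measurableSet_Icc fun α hα => ?_
      simp only [hD, hkdef, hyx t ht α hα, hyx t ht β hβ]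
    _ = ∫⁻ p, ENNReal.ofReal (D p) ∂(τ.prod (μ.prod μ)) := by
      rw [lintegral_prod _ hDm.ennreal_ofReal.aemeasurable]
      refine lintegral_congr fun t => ?_
      have hDt : Measurable fun q : ℝ × ℝ => D (t, q) :=
        hDm.comp (measurable_const.prodMk measurable_id)
      rw [lintegral_prod_symm _ hDt.ennreal_ofReal.aemeasurable]
    _ = ENNReal.ofReal (∫ p, D p ∂(τ.prod (μ.prod μ))) :=
      (ofReal_integral_eq_lintegral_ofReal hDi hD0).symm
    _ ≤ 1 := by
      rw [ENNReal.ofReal_le_one]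
      linarith

/-- For a symmetric weight function and any solution of the opinion
dynamics, the total dissipation
`∫_0^∞ ∫_0^1 ∫_0^1 w(t,α,β,x_t(α),x_t(β))·(x_t(β) − x_t(α))² dα dβ dt` is finite. -/
theorem total_dissipation_finite
    (W : ℝ) (hW : 0 < W) (w : ℝ → ℝ → ℝ → ℝ → ℝ → ℝ) (x : ℝ → ℝ → ℝ)
    (hw : IsWeight W w) (hsym : SymmetricWeight w) (hx : IsSolution w x) :
    (∫⁻ t in Ici (0:ℝ), ∫⁻ β in Icc (0:ℝ) 1, ∫⁻ α in Icc (0:ℝ) 1,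
      ENNReal.ofReal (w t α β (x t α) (x t β) * (x t β - x t α) ^ 2)) < ⊤ := by
  have hunion : Ioi (0:ℝ) = ⋃ n : ℕ, Ioc (0:ℝ) n := by
    ext t
    simp only [mem_Ioi, mem_iUnion, mem_Ioc]
    exact ⟨fun ht => (exists_nat_ge t).imp fun n hn => ⟨ht, hn⟩, fun ⟨_, ht⟩ => ht.1⟩
  have hmono : Monotone fun n : ℕ => Ioc (0:ℝ) n := fun m n hmn =>
    Ioc_subset_Ioc_right (Nat.cast_le.2 hmn)
  rw [setLIntegral_congr Ioi_ae_eq_Ici.symm, hunion,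
    setLIntegral_iUnion_of_directed _ hmono.directed_le]
  exact (iSup_le fun n => lintegral_dissipation_Ioc_le_one hw hsym hx n.cast_nonneg).trans_lt
    ENNReal.one_lt_top
end

section
/- Suppose the weight function w is symmetric and belongs to Γ(r,Δ) for some r > 0 and Δ > 0, x is a solution of the opinion dynamics, and μ_∞ is a finite Borel measure on [0,1] such that μ_t converges in distribution to μ_∞. Then any two distinct atoms of μ_∞ are at distance at least r: if a ≠ b, μ_∞({a}) > 0 and μ_∞({b}) > 0, then |a − b| ≥ r. -/
open MeasureTheory Filter Set Topology

/-- Symmetrization of the dissipation of the second moment. -/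
theorem integral_two_mul_symmetric_interaction {ν : Measure ℝ} [IsFiniteMeasure ν]
    {f : ℝ → ℝ} {K : ℝ → ℝ → ℝ} {M W : ℝ}
    (hf : Measurable f) (hK : Measurable (Function.uncurry K))
    (hfM : ∀ᵐ p ∂ν.prod ν, |f p.1| ≤ M ∧ |f p.2| ≤ M)
    (hKW : ∀ᵐ p ∂ν.prod ν, |K p.1 p.2| ≤ W)
    (hsym : ∀ α β, K α β = K β α) :
    ∫ α, 2 * f α * ∫ β, K α β * (f β - f α) ∂ν ∂ν =
      -∫ p, K p.1 p.2 * (f p.2 - f p.1) ^ 2 ∂ν.prod ν := by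
  have hKm : Measurable fun p : ℝ × ℝ => K p.1 p.2 := hK
  have hf1 : Measurable fun p : ℝ × ℝ => f p.1 := hf.comp measurable_fst
  have hf2 : Measurable fun p : ℝ × ℝ => f p.2 := hf.comp measurable_snd
  have hint : Integrable (fun p : ℝ × ℝ => f p.1 * (K p.1 p.2 * (f p.2 - f p.1)))
      (ν.prod ν) := by
    refine Integrable.of_bound
      (hf1.mul (hKm.mul (hf2.sub hf1))).aestronglyMeasurable (M * (W * (M + M))) ?_
    filter_upwards [hfM, hKW] with p hp hp'
    rw [Real.norm_eq_abs, abs_mul, abs_mul]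
    have hM : 0 ≤ M := (abs_nonneg _).trans hp.1
    have hW : 0 ≤ W := (abs_nonneg _).trans hp'
    have hd : |f p.2 - f p.1| ≤ M + M := (abs_sub _ _).trans (add_le_add hp.2 hp.1)
    gcongr
    exact hp.1
  have hswap := integral_prod_swap (μ := ν) (ν := ν)
    (fun p : ℝ × ℝ => f p.1 * (K p.1 p.2 * (f p.2 - f p.1)))
  have hint' := hint.swap
  simp only [Function.comp_def, Prod.fst_swap, Prod.snd_swap] at hint' hswap
  calc ∫ α, 2 * f α * ∫ β, K α β * (f β - f α) ∂ν ∂ν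
      = 2 * ∫ α, ∫ β, f α * (K α β * (f β - f α)) ∂ν ∂ν := by
        simp only [integral_const_mul, mul_assoc]
    _ = 2 * ∫ p, f p.1 * (K p.1 p.2 * (f p.2 - f p.1)) ∂ν.prod ν := by
        rw [integral_prod _ hint]
    _ = ∫ p, f p.1 * (K p.1 p.2 * (f p.2 - f p.1)) ∂ν.prod ν +
        ∫ p, f p.2 * (K p.2 p.1 * (f p.1 - f p.2)) ∂ν.prod ν := by
        rw [hswap]; ring
    _ = -∫ p, K p.1 p.2 * (f p.2 - f p.1) ^ 2 ∂ν.prod ν := by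
        rw [← integral_add hint hint', ← integral_neg]
        congr 1 with p
        rw [hsym p.2 p.1]
        ring

/-- Joint measurability of the opinions, extended to all times and agents by clamping. -/
theorem IsSolution.measurable_clamp {w : ℝ → ℝ → ℝ → ℝ → ℝ → ℝ} {x : ℝ → ℝ → ℝ}
    (hx : IsSolution w x) :
    Measurable (Function.uncurry fun t α => x (max t 0) (max 0 (min 1 α))) := by
  have hmem : ∀ α : ℝ, max 0 (min 1 α) ∈ Icc (0:ℝ) 1 := fun α =>
    ⟨le_max_left _ _, max_le zero_le_one (min_le_left _ _)⟩
  refine measurable_uncurry_of_continuous_of_measurable (fun α => ?_)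
    (fun t => (hx.meas _ (le_max_right _ _)).comp (by fun_prop))
  have hc : ContinuousOn (fun t => x t (max 0 (min 1 α))) (Ici 0) := by
    intro t ht
    have ht' : (0:ℝ) ≤ t + 1 := by linarith [mem_Ici.1 ht]
    have := ((hx.absCont _ (hmem α) (t + 1) ht').absolutelyContinuousOnInterval
      ht').continuousOn
    rw [uIcc_of_le ht'] at this
    refine (this t ⟨ht, by linarith⟩).mono_of_mem_nhdsWithin ?_
    rw [← Ici_inter_Iic]
    exact inter_mem_nhdsWithin _ (Iic_mem_nhds (by linarith))
  exact hc.comp_continuous (by fun_prop) fun t => mem_Ici.2 (le_max_right _ _)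

/-- The total interaction energy dissipated by the dynamics at time `t`. -/
noncomputable def dissipation (w : ℝ → ℝ → ℝ → ℝ → ℝ → ℝ) (x : ℝ → ℝ → ℝ) (t : ℝ) : ℝ :=
  ∫ p, w t p.1 p.2 (x t p.1) (x t p.2) * (x t p.2 - x t p.1) ^ 2
    ∂(volume.restrict (Icc (0:ℝ) 1)).prod (volume.restrict (Icc (0:ℝ) 1))

theorem ae_prod_restrict_mem {s : Set ℝ} (hs : MeasurableSet s) :
    ∀ᵐ p ∂(volume.restrict s).prod (volume.restrict s), p.1 ∈ s ∧ p.2 ∈ s := by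
  rw [Measure.prod_restrict]
  exact ae_restrict_mem (hs.prod hs)

theorem IsWeight.measurable_slice {W : ℝ} {w : ℝ → ℝ → ℝ → ℝ → ℝ → ℝ} {x : ℝ → ℝ → ℝ}
    (hw : IsWeight W w) (hx : IsSolution w x) {t : ℝ} (ht : 0 ≤ t) :
    Measurable (Function.uncurry fun α β => w t α β (x t α) (x t β)) :=
  hw.measurable.comp <| measurable_const.prodMk <| measurable_fst.prodMk <|
    measurable_snd.prodMk <| ((hx.meas t ht).comp measurable_fst).prodMk
      ((hx.meas t ht).comp measurable_snd)

theorem interactionField_eq_setIntegral (w : ℝ → ℝ → ℝ → ℝ → ℝ → ℝ) (x : ℝ → ℝ → ℝ)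
    (t α : ℝ) : interactionField w x t α =
      ∫ β in Icc (0:ℝ) 1, w t α β (x t α) (x t β) * (x t β - x t α) := by
  rw [interactionField, intervalIntegral.integral_of_le zero_le_one, integral_Icc_eq_integral_Ioc]

section Energy

variable {W : ℝ} {w : ℝ → ℝ → ℝ → ℝ → ℝ → ℝ} {x : ℝ → ℝ → ℝ}

theorem IsWeight.abs_le (hw : IsWeight W w) {t α β : ℝ} (ht : 0 ≤ t)
    (hα : α ∈ Icc (0:ℝ) 1) (hβ : β ∈ Icc (0:ℝ) 1) (a b : ℝ) : |w t α β a b| ≤ W := by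
  rw [abs_of_nonneg (hw.nonneg t ht α hα β hβ a b)]
  exact hw.le_bound t ht α hα β hβ a b

theorem IsSolution.integral_two_mul_interactionField (hw : IsWeight W w)
    (hsym : SymmetricWeight w) (hx : IsSolution w x) {t : ℝ} (ht : 0 ≤ t) :
    ∫ α in Icc (0:ℝ) 1, 2 * x t α * interactionField w x t α = -dissipation w x t := by
  obtain ⟨M, hM⟩ := hx.locBdd t ht
  simp only [interactionField_eq_setIntegral]
  refine integral_two_mul_symmetric_interaction (K := fun α β => w t α β (x t α) (x t β))
    (M := M) (W := W) (hx.meas t ht) (hw.measurable_slice hx ht) ?_ ?_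
    (fun α β => hsym _ _ _ _ _)
  · filter_upwards [ae_prod_restrict_mem measurableSet_Icc] with p hp
    exact ⟨hM _ hp.1 t ⟨ht, le_rfl⟩, hM _ hp.2 t ⟨ht, le_rfl⟩⟩
  · filter_upwards [ae_prod_restrict_mem measurableSet_Icc] with p hp
    exact hw.abs_le ht hp.1 hp.2 _ _

theorem abs_interactionField_le (hw : IsWeight W w) {M t α : ℝ} (ht : 0 ≤ t)
    (hM : ∀ α ∈ Icc (0:ℝ) 1, |x t α| ≤ M) (hα : α ∈ Icc (0:ℝ) 1) :
    |interactionField w x t α| ≤ W * (M + M) := by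
  rw [interactionField_eq_setIntegral, ← Real.norm_eq_abs]
  have h := norm_setIntegral_le_of_norm_le_const (μ := volume) (s := Icc (0:ℝ) 1)
    (f := fun β => w t α β (x t α) (x t β) * (x t β - x t α)) (C := W * (M + M))
    (by simp) (fun β hβ => by
      rw [Real.norm_eq_abs, abs_mul]
      have hW : 0 ≤ W := (abs_nonneg _).trans (hw.abs_le ht hα hβ (x t α) (x t β))
      gcongr
      · exact hw.abs_le ht hα hβ _ _
      · exact (abs_sub _ _).trans (add_le_add (hM β hβ) (hM α hα)))
  simpa using h

theorem IsSolution.sq_sub_sq_eq_integral (hx : IsSolution w x) {s t α : ℝ} (hs : 0 ≤ s)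
    (hst : s ≤ t) (hα : α ∈ Icc (0:ℝ) 1) :
    x t α ^ 2 - x s α ^ 2 =
      ∫ u in Ioc s t, 2 * x u α * interactionField w x u α := by
  have hac : AbsolutelyContinuousOnInterval (fun u => x u α) s t := by
    refine ((hx.absCont α hα t (hs.trans hst)).absolutelyContinuousOnInterval
      (hs.trans hst)).mono ?_
    rw [uIcc_of_le hst, uIcc_of_le (hs.trans hst)]
    exact Icc_subset_Icc_left hs
  have h := hac.integral_deriv_mul_eq_sub hac
  simp only [← sq] at h
  rw [← h, intervalIntegral.integral_of_le hst]
  have hode := ae_restrict_of_ae_restrict_of_subset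
    (fun u hu => hs.trans (le_of_lt hu.1) : Ioc s t ⊆ Ici 0) (hx.ode α hα)
  refine integral_congr_ae ?_
  filter_upwards [hode] with u hu
  rw [hu.deriv]
  ring

theorem IsSolution.integrable_two_mul_interactionField (hw : IsWeight W w)
    (hx : IsSolution w x) {s t : ℝ} (hs : 0 ≤ s) (hst : s ≤ t) :
    Integrable (Function.uncurry fun u α => 2 * x u α * interactionField w x u α)
      ((volume.restrict (Ioc s t)).prod (volume.restrict (Icc (0:ℝ) 1))) := by
  obtain ⟨M, hM⟩ := hx.locBdd t (hs.trans hst)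
  have hmem : ∀ᵐ p ∂(volume.restrict (Ioc s t)).prod (volume.restrict (Icc (0:ℝ) 1)),
      p.1 ∈ Ioc s t ∧ p.2 ∈ Icc (0:ℝ) 1 := by
    rw [Measure.prod_restrict]
    exact ae_restrict_mem (measurableSet_Ioc.prod measurableSet_Icc)
  have hy := hx.measurable_clamp
  set y : ℝ → ℝ → ℝ := fun t α => x (max t 0) (max 0 (min 1 α)) with hydef
  have hyx : ∀ u α, 0 ≤ u → α ∈ Icc (0:ℝ) 1 → y u α = x u α := by
    intro u α hu hα
    simp [hydef, hu, hα.1, hα.2]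
  have hyuα : Measurable fun p : (ℝ × ℝ) × ℝ => y p.1.1 p.1.2 :=
    hy.comp measurable_fst
  have hyuβ : Measurable fun p : (ℝ × ℝ) × ℝ => y p.1.1 p.2 :=
    hy.comp ((measurable_fst.comp measurable_fst).prodMk measurable_snd)
  have hwy : Measurable fun p : (ℝ × ℝ) × ℝ =>
      w p.1.1 p.1.2 p.2 (y p.1.1 p.1.2) (y p.1.1 p.2) :=
    hw.measurable.comp <| (measurable_fst.comp measurable_fst).prodMk <|
      (measurable_snd.comp measurable_fst).prodMk <| measurable_snd.prodMk <|
      hyuα.prodMk hyuβ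
  have hV : StronglyMeasurable fun q : ℝ × ℝ => ∫ β in Icc (0:ℝ) 1,
      w q.1 q.2 β (y q.1 q.2) (y q.1 β) * (y q.1 β - y q.1 q.2) :=
    (hwy.mul (hyuβ.sub hyuα)).stronglyMeasurable.integral_prod_right
  have hy2 : Measurable fun q : ℝ × ℝ => 2 * y q.1 q.2 := hy.const_mul 2
  have hmeas : AEStronglyMeasurable
      (Function.uncurry fun u α => 2 * x u α * interactionField w x u α)
      ((volume.restrict (Ioc s t)).prod (volume.restrict (Icc (0:ℝ) 1))) := by
    refine (hy2.stronglyMeasurable.mul hV).aestronglyMeasurable.congr ?_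
    filter_upwards [hmem] with p hp
    have hp0 : 0 ≤ p.1 := hs.trans hp.1.1.le
    simp only [Pi.mul_apply, Function.uncurry, hyx p.1 p.2 hp0 hp.2,
      interactionField_eq_setIntegral]
    congr 1
    refine setIntegral_congr_fun measurableSet_Icc fun β hβ => ?_
    simp only [hyx p.1 β hp0 hβ]
  refine Integrable.of_bound hmeas (2 * M * (W * (M + M))) ?_
  filter_upwards [hmem] with p hp
  have hp0 : 0 ≤ p.1 := hs.trans hp.1.1.le
  have hM' : ∀ α ∈ Icc (0:ℝ) 1, |x p.1 α| ≤ M := fun α hα => hM α hα p.1 ⟨hp0, hp.1.2⟩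
  have hM0 : 0 ≤ M := (abs_nonneg _).trans (hM' _ hp.2)
  simp only [Function.uncurry, Real.norm_eq_abs, abs_mul, abs_two]
  gcongr
  · exact hM' _ hp.2
  · exact abs_interactionField_le hw hp0 hM' hp.2

theorem IsSolution.integrable_sq (hx : IsSolution w x) {t : ℝ} (ht : 0 ≤ t) :
    Integrable (fun α => x t α ^ 2) (volume.restrict (Icc (0:ℝ) 1)) := by
  obtain ⟨M, hM⟩ := hx.locBdd t ht
  refine Integrable.of_bound ((hx.meas t ht).pow_const 2).aestronglyMeasurable (M ^ 2) ?_
  filter_upwards [ae_restrict_mem measurableSet_Icc] with α hα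
  rw [Real.norm_eq_abs, abs_pow]
  gcongr
  exact hM α hα t ⟨ht, le_rfl⟩

/-- The second moment decreases at least linearly while the dissipation stays above `k`. -/
theorem IsSolution.integral_sq_le_of_le_dissipation (hw : IsWeight W w)
    (hsym : SymmetricWeight w) (hx : IsSolution w x) {s t k : ℝ} (hs : 0 ≤ s) (hst : s ≤ t)
    (hk : ∀ u ∈ Ioc s t, k ≤ dissipation w x u) :
    ∫ α in Icc (0:ℝ) 1, x t α ^ 2 ≤ (∫ α in Icc (0:ℝ) 1, x s α ^ 2) - k * (t - s) := by
  have hint := hx.integrable_two_mul_interactionField hw hs hst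
  have heq : (∫ α in Icc (0:ℝ) 1, x t α ^ 2) - ∫ α in Icc (0:ℝ) 1, x s α ^ 2 =
      ∫ u in Ioc s t, ∫ α in Icc (0:ℝ) 1, 2 * x u α * interactionField w x u α := by
    rw [← integral_sub (hx.integrable_sq (hs.trans hst)) (hx.integrable_sq hs),
      integral_integral_swap hint]
    exact setIntegral_congr_fun measurableSet_Icc fun α hα =>
      hx.sq_sub_sq_eq_integral hs hst hα
  have hle : ∫ u in Ioc s t, ∫ α in Icc (0:ℝ) 1, 2 * x u α * interactionField w x u α ≤
      ∫ _u in Ioc s t, -k := by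
    refine setIntegral_mono_on hint.integral_prod_left (integrable_const _)
      measurableSet_Ioc fun u hu => ?_
    rw [hx.integral_two_mul_interactionField hw hsym (hs.trans hu.1.le)]
    exact neg_le_neg (hk u hu)
  have hconst : ∫ _u in Ioc s t, -k = -(k * (t - s)) := by
    simp [hst, mul_comm]
  linarith

/-- A lower bound of product form on the pairwise dissipation integrates to a lower bound by the
masses that `f` and `g` see in the opinion distribution. -/
theorem IsSolution.le_dissipation (hw : IsWeight W w) (hx : IsSolution w x) {t c : ℝ}
    (ht : 0 ≤ t) {f g : BoundedContinuousFunction ℝ ℝ}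
    (h : ∀ α ∈ Icc (0:ℝ) 1, ∀ β ∈ Icc (0:ℝ) 1,
      c * (f (x t α) * g (x t β)) ≤ w t α β (x t α) (x t β) * (x t β - x t α) ^ 2) :
    c * ((∫ y, f y ∂opinionMeasure x t) * ∫ y, g y ∂opinionMeasure x t) ≤
      dissipation w x t := by
  obtain ⟨M, hM⟩ := hx.locBdd t ht
  have hxm := hx.meas t ht
  have hmap : ∀ f : BoundedContinuousFunction ℝ ℝ,
      ∫ y, f y ∂opinionMeasure x t = ∫ α in Icc (0:ℝ) 1, f (x t α) := fun f =>
    integral_map hxm.aemeasurable f.continuous.aestronglyMeasurable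
  have hfi : ∀ f : BoundedContinuousFunction ℝ ℝ,
      Integrable (fun α => f (x t α)) (volume.restrict (Icc (0:ℝ) 1)) := fun f =>
    Integrable.of_bound (f.continuous.measurable.comp hxm).aestronglyMeasurable ‖f‖
      (Eventually.of_forall fun α => f.norm_coe_le_norm _)
  rw [hmap f, hmap g, ← integral_prod_mul, ← integral_const_mul, dissipation]
  refine integral_mono_ae (((hfi f).mul_prod (hfi g)).const_mul c) ?_ ?_
  · refine Integrable.of_bound ((hw.measurable_slice hx ht).mul (((hxm.comp measurable_snd).sub
      (hxm.comp measurable_fst)).pow_const 2)).aestronglyMeasurable (W * (M + M) ^ 2) ?_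
    filter_upwards [ae_prod_restrict_mem measurableSet_Icc] with p hp
    have hW : 0 ≤ W := (abs_nonneg _).trans (hw.abs_le ht hp.1 hp.2 (x t p.1) (x t p.2))
    rw [Real.norm_eq_abs, abs_mul, abs_pow]
    gcongr
    · exact hw.abs_le ht hp.1 hp.2 _ _
    · exact (abs_sub _ _).trans
        (add_le_add (hM _ hp.2 t ⟨ht, le_rfl⟩) (hM _ hp.1 t ⟨ht, le_rfl⟩))
  · filter_upwards [ae_prod_restrict_mem measurableSet_Icc] with p hp
    exact h _ hp.1 _ hp.2

end Energy

/-- The tent function of height one and half-width `ε` centred at `a`. -/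
noncomputable def tent (a ε : ℝ) : BoundedContinuousFunction ℝ ℝ :=
  BoundedContinuousFunction.ofNormedAddCommGroup (fun y => max 0 (1 - |y - a| / |ε|))
    (by fun_prop) 1 (fun y => by
      rw [Real.norm_eq_abs, abs_of_nonneg (le_max_left _ _)]
      exact max_le zero_le_one (by linarith [show 0 ≤ |y - a| / |ε| by positivity]))

theorem tent_apply (a ε y : ℝ) : tent a ε y = max 0 (1 - |y - a| / |ε|) := rfl

theorem tent_nonneg (a ε y : ℝ) : 0 ≤ tent a ε y := le_max_left _ _

theorem tent_le_one (a ε y : ℝ) : tent a ε y ≤ 1 :=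
  max_le zero_le_one (by linarith [show 0 ≤ |y - a| / |ε| by positivity])

theorem tent_eq_zero {a ε y : ℝ} (hε : 0 < ε) (h : ε ≤ |y - a|) : tent a ε y = 0 := by
  rw [tent_apply, abs_of_pos hε]
  refine max_eq_left ?_
  rw [sub_nonpos, le_div_iff₀ hε]
  linarith

theorem integral_tent_pos {μ : Measure ℝ} [IsFiniteMeasure μ] {a : ℝ} (ε : ℝ)
    (ha : 0 < μ {a}) : 0 < ∫ y, tent a ε y ∂μ := by
  rw [integral_pos_iff_support_of_nonneg (tent_nonneg a ε) ((tent a ε).integrable μ)]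
  refine ha.trans_le (measure_mono ?_)
  simp [tent_apply]

/-- Suppose the symmetric weight function belongs to `Γ(r,Δ)`, `x` is a
solution, and the opinion distributions converge in distribution to a finite Borel
measure `μ∞` on `[0,1]`. Then any two distinct atoms of `μ∞` are at distance at least
`r`. -/
theorem atoms_of_limit_measure_are_separated
    (W r Δ : ℝ) (hW : 0 < W) (hr : 0 < r) (hΔ : 0 < Δ)
    (w : ℝ → ℝ → ℝ → ℝ → ℝ → ℝ) (x : ℝ → ℝ → ℝ)
    (hw : IsWeight W w) (hsym : SymmetricWeight w) (hΓ : InGamma r Δ w)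
    (hx : IsSolution w x)
    (μlim : Measure ℝ) (hfin : IsFiniteMeasure μlim) (hsupp : μlim (Icc (0:ℝ) 1)ᶜ = 0)
    (hconv : ∀ η : BoundedContinuousFunction ℝ ℝ,
      Tendsto (fun t => ∫ y, η y ∂(opinionMeasure x t)) atTop
        (𝓝 (∫ y, η y ∂μlim))) :
    ∀ a b : ℝ, a ≠ b → 0 < μlim {a} → 0 < μlim {b} → r ≤ |a - b| := by
  intro a b hab ha hb
  by_contra! hlt
  have hd : 0 < |a - b| := abs_pos.2 (sub_ne_zero.2 hab)
  obtain ⟨ε, hε, hεr, hεd⟩ : ∃ ε > 0, |a - b| + 2 * ε ≤ r ∧ 4 * ε ≤ |a - b| :=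
    ⟨min ((r - |a - b|) / 2) (|a - b| / 4), by apply lt_min <;> linarith,
      by linarith [min_le_left ((r - |a - b|) / 2) (|a - b| / 4)],
      by linarith [min_le_right ((r - |a - b|) / 2) (|a - b| / 4)]⟩
  set A := ∫ y, tent a ε y ∂μlim
  set B := ∫ y, tent b ε y ∂μlim
  have hA : 0 < A := integral_tent_pos ε ha
  have hB : 0 < B := integral_tent_pos ε hb
  set c := Δ * (|a - b| / 2) ^ 2
  have hc0 : 0 < c := by positivity
  have hpt : ∀ t, 0 ≤ t → ∀ α ∈ Icc (0:ℝ) 1, ∀ β ∈ Icc (0:ℝ) 1,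
      c * (tent a ε (x t α) * tent b ε (x t β)) ≤
        w t α β (x t α) (x t β) * (x t β - x t α) ^ 2 := by
    intro t ht α hα β hβ
    have hw0 := hw.nonneg t ht α hα β hβ (x t α) (x t β)
    rcases le_or_gt ε |x t α - a| with h | hα'
    · rw [tent_eq_zero hε h, zero_mul, mul_zero]
      positivity
    rcases le_or_gt ε |x t β - b| with h | hβ'
    · rw [tent_eq_zero hε h, mul_zero, mul_zero]
      positivity
    have hnear : |x t α - x t β| ≤ r := by
      grind
    have hfar : |a - b| / 2 ≤ |x t β - x t α| := by
      grind
    calc c * (tent a ε (x t α) * tent b ε (x t β)) ≤ c * 1 := by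
          gcongr
          exact mul_le_one₀ (tent_le_one _ _ _) (tent_nonneg _ _ _) (tent_le_one _ _ _)
      _ = Δ * (|a - b| / 2) ^ 2 := mul_one c
      _ ≤ w t α β (x t α) (x t β) * |x t β - x t α| ^ 2 := by
          gcongr
          exact hΓ t ht α hα β hβ _ _ hnear
      _ = _ := by rw [sq_abs]
  have hev : ∀ᶠ t in atTop, c * (A / 2 * (B / 2)) ≤ dissipation w x t := by
    filter_upwards [eventually_ge_atTop 0, (hconv (tent a ε)).eventually_const_le (half_lt_self hA),
      (hconv (tent b ε)).eventually_const_le (half_lt_self hB)] with t ht h₁ h₂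
    refine le_trans ?_ (hx.le_dissipation hw ht (hpt t ht))
    gcongr
    exact integral_nonneg (tent_nonneg a ε)
  obtain ⟨T, hT⟩ := eventually_atTop.1 (hev.and (eventually_ge_atTop 0))
  have hT0 : 0 ≤ T := (hT T le_rfl).2
  set k := c * (A / 2 * (B / 2))
  have hk : 0 < k := by positivity
  set E := ∫ α in Icc (0:ℝ) 1, x T α ^ 2
  have hE : 0 ≤ E := integral_nonneg fun α => sq_nonneg _
  have hdecay := hx.integral_sq_le_of_le_dissipation hw hsym (t := T + (E + 1) / k) (k := k) hT0
    (le_add_of_nonneg_right (by positivity)) fun u hu => (hT u hu.1.le).1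
  have hnonneg : 0 ≤ ∫ α in Icc (0:ℝ) 1, x (T + (E + 1) / k) α ^ 2 :=
    integral_nonneg fun α => sq_nonneg _
  rw [add_sub_cancel_left, mul_div_cancel₀ _ hk.ne'] at hdecay
  linarith
end

section
/- Suppose the weight function w is symmetric and belongs to Γ(r,Δ) for some r > 0 and Δ > 0, and x is a solution of the opinion dynamics. Let I, I' ⊆ ℝ be intervals and δ > 0 such that δ ≤ |y − y'| ≤ r for all y ∈ I and y' ∈ I', and suppose liminf_{t→∞} μ_t(I') > 0. Then ∫_0^∞ μ_t(I) dt < ∞. -/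
open MeasureTheory Filter Set Topology

/-- The mean squared disagreement `∬ k(α,β) (u β − u α)² dβ dα`. -/
noncomputable def disagreement {Ω : Type*} [MeasurableSpace Ω] (ν : Measure Ω)
    (k : Ω → Ω → ℝ) (u : Ω → ℝ) : ℝ :=
  ∫ p : Ω × Ω, k p.1 p.2 * (u p.2 - u p.1) ^ 2 ∂(ν.prod ν)

theorem abs_kernel_mul_sub_le {Ω : Type*} {k : Ω → Ω → ℝ} {u : Ω → ℝ} {W M : ℝ}
    (hk0 : ∀ a b, 0 ≤ k a b) (hkW : ∀ a b, k a b ≤ W) (hu : ∀ a, |u a| ≤ M) (a b : Ω) :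
    |k a b * (u b - u a)| ≤ W * (2 * M) := by
  rw [abs_mul, abs_of_nonneg (hk0 a b)]
  have h := (abs_sub (u b) (u a)).trans (add_le_add (hu b) (hu a))
  exact mul_le_mul (hkW a b) (by linarith) (abs_nonneg _) ((hk0 a b).trans (hkW a b))

theorem disagreement_nonneg {Ω : Type*} [MeasurableSpace Ω] {ν : Measure Ω} {k : Ω → Ω → ℝ}
    {u : Ω → ℝ} (hk0 : ∀ a b, 0 ≤ k a b) : 0 ≤ disagreement ν k u :=
  integral_nonneg fun p => mul_nonneg (hk0 p.1 p.2) (sq_nonneg _)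

section Kernel

variable {Ω : Type*} [MeasurableSpace Ω] {ν : Measure Ω} [IsProbabilityMeasure ν]
  {k : Ω → Ω → ℝ} {u : Ω → ℝ} {W M : ℝ}

theorem integrable_kernel_mul_sub_sq (hk : Measurable (Function.uncurry k))
    (hum : Measurable u) (hk0 : ∀ a b, 0 ≤ k a b) (hkW : ∀ a b, k a b ≤ W)
    (hu : ∀ a, |u a| ≤ M) :
    Integrable (fun p : Ω × Ω => k p.1 p.2 * (u p.2 - u p.1) ^ 2) (ν.prod ν) := by
  have hk' : Measurable fun p : Ω × Ω => k p.1 p.2 := hk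
  refine Integrable.of_bound (C := W * (2 * M) * (2 * M))
    (by fun_prop : Measurable _).aestronglyMeasurable (ae_of_all _ fun p => ?_)
  have h1 := abs_kernel_mul_sub_le hk0 hkW hu p.1 p.2
  have h2 := (abs_sub (u p.2) (u p.1)).trans (add_le_add (hu p.2) (hu p.1))
  rw [Real.norm_eq_abs, pow_two, ← mul_assoc, abs_mul]
  exact mul_le_mul h1 (by linarith) (abs_nonneg _) ((abs_nonneg _).trans h1)

theorem integral_two_mul_mul_integral_kernel (hk : Measurable (Function.uncurry k))
    (hum : Measurable u) (hk0 : ∀ a b, 0 ≤ k a b) (hkW : ∀ a b, k a b ≤ W)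
    (hu : ∀ a, |u a| ≤ M) (hsym : ∀ a b, k a b = k b a) :
    ∫ a, 2 * (u a * ∫ b, k a b * (u b - u a) ∂ν) ∂ν = -disagreement ν k u := by
  have hk' : Measurable fun p : Ω × Ω => k p.1 p.2 := hk
  have hint : Integrable (fun p : Ω × Ω => u p.1 * (k p.1 p.2 * (u p.2 - u p.1)))
      (ν.prod ν) := by
    refine Integrable.of_bound (C := M * (W * (2 * M)))
      (by fun_prop : Measurable _).aestronglyMeasurable (ae_of_all _ fun p => ?_)
    rw [Real.norm_eq_abs, abs_mul]
    exact mul_le_mul (hu p.1) (abs_kernel_mul_sub_le hk0 hkW hu p.1 p.2) (abs_nonneg _)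
      ((abs_nonneg _).trans (hu p.1))
  have h1 : ∫ a, u a * ∫ b, k a b * (u b - u a) ∂ν ∂ν
      = ∫ p : Ω × Ω, u p.1 * (k p.1 p.2 * (u p.2 - u p.1)) ∂(ν.prod ν) := by
    rw [integral_prod _ hint]
    simp_rw [integral_const_mul]
  have h2 := integral_prod_swap (μ := ν) (ν := ν)
    (fun p : Ω × Ω => u p.1 * (k p.1 p.2 * (u p.2 - u p.1)))
  rw [integral_const_mul, two_mul, h1]
  nth_rewrite 1 [← h2]
  have hadd := integral_add hint.swap hint
  simp only [Function.comp_apply] at hadd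
  rw [← hadd, disagreement, ← integral_neg]
  refine integral_congr_ae (ae_of_all _ fun p => ?_)
  simp only [Prod.fst_swap, Prod.snd_swap]
  rw [hsym p.2 p.1]
  ring

theorem mul_measureReal_le_disagreement (hk : Measurable (Function.uncurry k))
    (hum : Measurable u) (hk0 : ∀ a b, 0 ≤ k a b) (hkW : ∀ a b, k a b ≤ W)
    (hu : ∀ a, |u a| ≤ M) {A B : Set Ω} (hA : MeasurableSet A) (hB : MeasurableSet B)
    {c : ℝ} (hc : ∀ a ∈ A, ∀ b ∈ B, c ≤ k a b * (u b - u a) ^ 2) :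
    c * (ν.real A * ν.real B) ≤ disagreement ν k u := by
  have hAB := hA.prod hB
  have h1 : c * (ν.real A * ν.real B)
      = ∫ p : Ω × Ω, (A ×ˢ B).indicator (fun _ => c) p ∂(ν.prod ν) := by
    rw [integral_indicator_const _ hAB, measureReal_prod_prod, smul_eq_mul, mul_comm]
  rw [h1]
  refine integral_mono ((integrable_const c).indicator hAB)
    (integrable_kernel_mul_sub_sq hk hum hk0 hkW hu) fun p => ?_
  by_cases hp : p ∈ A ×ˢ B
  · simpa [hp] using hc p.1 hp.1 p.2 hp.2
  · simpa [hp] using mul_nonneg (hk0 p.1 p.2) (sq_nonneg (u p.2 - u p.1))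

/-- Energy balance for a symmetric averaging flow: the time integral of the disagreement is the
decrease of the second moment. -/
theorem integral_disagreement_eq {y : ℝ → Ω → ℝ} {k : ℝ → Ω → Ω → ℝ} {T : ℝ} (hT : 0 ≤ T)
    (hk : Measurable fun p : ℝ × Ω × Ω => k p.1 p.2.1 p.2.2)
    (hy : Measurable (Function.uncurry y))
    (hk0 : ∀ t a b, 0 ≤ k t a b) (hkW : ∀ t a b, k t a b ≤ W)
    (hsym : ∀ t a b, k t a b = k t b a)
    (hM : ∀ t ∈ Icc 0 T, ∀ a, |y t a| ≤ M)
    (hftc : ∀ a, ∫ t in (0:ℝ)..T, 2 * (y t a * ∫ b, k t a b * (y t b - y t a) ∂ν)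
      = y T a ^ 2 - y 0 a ^ 2) :
    ∫ t in (0:ℝ)..T, disagreement ν (k t) (y t) = ∫ a, y 0 a ^ 2 ∂ν - ∫ a, y T a ^ 2 ∂ν := by
  have hyt : ∀ t, Measurable (y t) := fun t => hy.comp (by fun_prop : Measurable fun a => (t, a))
  have hkt : ∀ t, Measurable (Function.uncurry (k t)) := fun t =>
    hk.comp (by fun_prop : Measurable fun p : Ω × Ω => (t, p.1, p.2))
  have hsq : ∀ t ∈ Icc 0 T, Integrable (fun a => y t a ^ 2) ν := fun t ht => by
    refine Integrable.of_bound (C := M ^ 2) ((hyt t).pow_const 2).aestronglyMeasurable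
      (ae_of_all _ fun a => ?_)
    rw [norm_pow, Real.norm_eq_abs]
    exact pow_le_pow_left₀ (abs_nonneg _) (hM t ht a) 2
  have hFm : Measurable fun q : Ω × ℝ => ∫ b, k q.2 q.1 b * (y q.2 b - y q.2 q.1) ∂ν := by
    have h : Measurable fun z : (Ω × ℝ) × Ω =>
        k z.1.2 z.1.1 z.2 * (y z.1.2 z.2 - y z.1.2 z.1.1) :=
      (hk.comp (by fun_prop : Measurable fun z : (Ω × ℝ) × Ω => (z.1.2, z.1.1, z.2))).mul
        ((hy.comp (by fun_prop : Measurable fun z : (Ω × ℝ) × Ω => (z.1.2, z.2))).sub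
        (hy.comp (by fun_prop : Measurable fun z : (Ω × ℝ) × Ω => (z.1.2, z.1.1))))
    exact (h.stronglyMeasurable.integral_prod_right').measurable
  have hGm : Measurable fun q : Ω × ℝ =>
      2 * (y q.2 q.1 * ∫ b, k q.2 q.1 b * (y q.2 b - y q.2 q.1) ∂ν) :=
    ((hy.comp (by fun_prop : Measurable fun z : Ω × ℝ => (z.2, z.1))).mul hFm).const_mul 2
  have hGi : Integrable (fun q : Ω × ℝ =>
      2 * (y q.2 q.1 * ∫ b, k q.2 q.1 b * (y q.2 b - y q.2 q.1) ∂ν))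
      (ν.prod (volume.restrict (Ioc 0 T))) := by
    refine Integrable.of_bound (C := 2 * (M * (W * (2 * M)))) hGm.aestronglyMeasurable ?_
    filter_upwards [Measure.quasiMeasurePreserving_snd.ae
      (ae_restrict_mem (measurableSet_Ioc (a := (0:ℝ)) (b := T)))] with q hq
    have hMq := hM q.2 (Ioc_subset_Icc_self hq)
    have hF : |∫ b, k q.2 q.1 b * (y q.2 b - y q.2 q.1) ∂ν| ≤ W * (2 * M) := by
      have := norm_integral_le_of_norm_le_const (μ := ν) (C := W * (2 * M))
        (f := fun b => k q.2 q.1 b * (y q.2 b - y q.2 q.1))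
        (ae_of_all _ fun b => abs_kernel_mul_sub_le (hk0 q.2) (hkW q.2) hMq q.1 b)
      simpa using this
    rw [Real.norm_eq_abs, abs_mul, abs_mul, abs_two]
    have := mul_le_mul (hMq q.1) hF (abs_nonneg _) ((abs_nonneg _).trans (hMq q.1))
    linarith
  have hswap := integral_integral_swap (μ := ν) (ν := volume.restrict (Ioc 0 T))
    (f := fun a t => 2 * (y t a * ∫ b, k t a b * (y t b - y t a) ∂ν)) hGi
  simp_rw [intervalIntegral.integral_of_le hT] at hftc ⊢
  simp_rw [hftc] at hswap
  rw [integral_sub (hsq T ⟨hT, le_rfl⟩) (hsq 0 ⟨le_rfl, hT⟩)] at hswap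
  have h2 : ∫ t in Ioc 0 T, ∫ a, 2 * (y t a * ∫ b, k t a b * (y t b - y t a) ∂ν) ∂ν
      = ∫ t in Ioc 0 T, -disagreement ν (k t) (y t) :=
    setIntegral_congr_fun measurableSet_Ioc fun t ht =>
      integral_two_mul_mul_integral_kernel (hkt t) (hyt t) (hk0 t) (hkW t)
        (hM t (Ioc_subset_Icc_self ht)) (hsym t)
  rw [h2, integral_neg] at hswap
  linarith

end Kernel

/-- A solution of the opinion dynamics, extended constantly outside `[0,∞) × [0,1]`. -/
noncomputable def clampedOpinion (x : ℝ → ℝ → ℝ) (t α : ℝ) : ℝ :=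
  x (max t 0) (projIcc (0:ℝ) 1 zero_le_one α)

/-- The interaction weight along a solution, extended constantly outside
`[0,∞) × [0,1] × [0,1]`. -/
noncomputable def clampedWeight (w : ℝ → ℝ → ℝ → ℝ → ℝ → ℝ) (x : ℝ → ℝ → ℝ)
    (t α β : ℝ) : ℝ :=
  w (max t 0) (projIcc (0:ℝ) 1 zero_le_one α) (projIcc (0:ℝ) 1 zero_le_one β)
    (clampedOpinion x t α) (clampedOpinion x t β)

theorem clampedOpinion_eq {x : ℝ → ℝ → ℝ} {t α : ℝ} (ht : 0 ≤ t) (hα : α ∈ Icc (0:ℝ) 1) :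
    clampedOpinion x t α = x t α := by
  rw [clampedOpinion, max_eq_left ht, projIcc_of_mem _ hα]

theorem measurable_coe_projIcc :
    Measurable fun α : ℝ => (projIcc (0:ℝ) 1 zero_le_one α : ℝ) :=
  (continuous_subtype_val.comp continuous_projIcc).measurable

theorem measurable_clampedOpinion {w : ℝ → ℝ → ℝ → ℝ → ℝ → ℝ} {x : ℝ → ℝ → ℝ}
    (hx : IsSolution w x) : Measurable (Function.uncurry (clampedOpinion x)) := by
  refine measurable_uncurry_of_continuous_of_measurable (fun α => ?_) fun t =>
    (hx.meas _ (le_max_right t 0)).comp measurable_coe_projIcc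
  have hcont : ContinuousOn (fun s => x s (projIcc (0:ℝ) 1 zero_le_one α)) (Ici 0) := by
    intro t ht
    have ht1 : (0:ℝ) ≤ t + 1 := by linarith [mem_Ici.1 ht]
    have h := ((hx.absCont _ (projIcc (0:ℝ) 1 zero_le_one α).2 (t + 1)
      ht1).absolutelyContinuousOnInterval ht1).continuousOn
    rw [uIcc_of_le ht1] at h
    have hmem : Icc 0 (t + 1) ∈ 𝓝[Ici 0] t := by
      rw [← Ici_inter_Iic]
      exact inter_mem self_mem_nhdsWithin
        (mem_nhdsWithin_of_mem_nhds (Iic_mem_nhds (lt_add_one t)))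
    exact (h t ⟨ht, (lt_add_one t).le⟩).mono_of_mem_nhdsWithin hmem
  exact hcont.comp_continuous (by fun_prop) fun t => le_max_right t 0

theorem measurable_clampedWeight {W : ℝ} {w : ℝ → ℝ → ℝ → ℝ → ℝ → ℝ} {x : ℝ → ℝ → ℝ}
    (hw : IsWeight W w) (hx : IsSolution w x) :
    Measurable fun p : ℝ × ℝ × ℝ => clampedWeight w x p.1 p.2.1 p.2.2 := by
  have hy := measurable_clampedOpinion hx
  have hp := measurable_coe_projIcc
  refine hw.measurable.comp (f := fun p : ℝ × ℝ × ℝ => (max p.1 0,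
    (projIcc (0:ℝ) 1 zero_le_one p.2.1 : ℝ), (projIcc (0:ℝ) 1 zero_le_one p.2.2 : ℝ),
    clampedOpinion x p.1 p.2.1, clampedOpinion x p.1 p.2.2)) ?_
  exact (measurable_fst.max measurable_const).prodMk
    ((hp.comp measurable_snd.fst).prodMk ((hp.comp measurable_snd.snd).prodMk
    ((hy.comp (measurable_fst.prodMk measurable_snd.fst)).prodMk
    (hy.comp (measurable_fst.prodMk measurable_snd.snd)))))

theorem clampedWeight_nonneg {W : ℝ} {w : ℝ → ℝ → ℝ → ℝ → ℝ → ℝ} {x : ℝ → ℝ → ℝ}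
    (hw : IsWeight W w) (t α β : ℝ) : 0 ≤ clampedWeight w x t α β :=
  hw.nonneg _ (le_max_right t 0) _ (projIcc _ _ _ α).2 _ (projIcc _ _ _ β).2 _ _

theorem clampedWeight_le {W : ℝ} {w : ℝ → ℝ → ℝ → ℝ → ℝ → ℝ} {x : ℝ → ℝ → ℝ}
    (hw : IsWeight W w) (t α β : ℝ) : clampedWeight w x t α β ≤ W :=
  hw.le_bound _ (le_max_right t 0) _ (projIcc _ _ _ α).2 _ (projIcc _ _ _ β).2 _ _

theorem exists_abs_clampedOpinion_le {w : ℝ → ℝ → ℝ → ℝ → ℝ → ℝ} {x : ℝ → ℝ → ℝ}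
    (hx : IsSolution w x) {T : ℝ} (hT : 0 ≤ T) :
    ∃ M, ∀ t ∈ Icc 0 T, ∀ α, |clampedOpinion x t α| ≤ M := by
  obtain ⟨M, hM⟩ := hx.locBdd T hT
  refine ⟨M, fun t ht α => ?_⟩
  rw [clampedOpinion, max_eq_left ht.1]
  exact hM _ (projIcc _ _ _ α).2 t ht

theorem interactionField_eq_integral_clamped {w : ℝ → ℝ → ℝ → ℝ → ℝ → ℝ} {x : ℝ → ℝ → ℝ}
    {t : ℝ} (ht : 0 ≤ t) (α : ℝ) :
    interactionField w x t (projIcc (0:ℝ) 1 zero_le_one α)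
      = ∫ β in Icc (0:ℝ) 1, clampedWeight w x t α β *
        (clampedOpinion x t β - clampedOpinion x t α) := by
  rw [interactionField, intervalIntegral.integral_of_le zero_le_one, ← integral_Icc_eq_integral_Ioc]
  refine setIntegral_congr_fun measurableSet_Icc fun β hβ => ?_
  simp only [clampedWeight, clampedOpinion, max_eq_left ht, projIcc_of_mem zero_le_one hβ]

theorem integral_two_mul_clampedOpinion_mul_field {w : ℝ → ℝ → ℝ → ℝ → ℝ → ℝ}
    {x : ℝ → ℝ → ℝ} (hx : IsSolution w x) {T : ℝ} (hT : 0 ≤ T) (α : ℝ) :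
    ∫ t in (0:ℝ)..T, 2 * (clampedOpinion x t α * ∫ β in Icc (0:ℝ) 1,
        clampedWeight w x t α β * (clampedOpinion x t β - clampedOpinion x t α))
      = clampedOpinion x T α ^ 2 - clampedOpinion x 0 α ^ 2 := by
  have hα := (projIcc (0:ℝ) 1 zero_le_one α).2
  have hac := (hx.absCont _ hα T hT).absolutelyContinuousOnInterval hT
  have h := hac.integral_deriv_mul_eq_sub hac
  have hode := hx.ode _ hα
  rw [ae_restrict_iff' measurableSet_Ici] at hode
  rw [clampedOpinion, clampedOpinion, max_eq_left hT, max_self, pow_two, pow_two, ← h]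
  refine intervalIntegral.integral_congr_ae ?_
  filter_upwards [hode] with t ht htm
  rw [uIoc_of_le hT] at htm
  have ht0 : 0 ≤ t := htm.1.le
  rw [(ht ht0).deriv, interactionField_eq_integral_clamped ht0]
  simp only [clampedOpinion, max_eq_left ht0]
  ring

theorem measurable_disagreement_clamped {W : ℝ} {w : ℝ → ℝ → ℝ → ℝ → ℝ → ℝ}
    {x : ℝ → ℝ → ℝ} (hw : IsWeight W w) (hx : IsSolution w x) :
    Measurable fun t => disagreement (volume.restrict (Icc (0:ℝ) 1))
      (clampedWeight w x t) (clampedOpinion x t) := by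
  have hy := measurable_clampedOpinion hx
  have h : Measurable fun z : ℝ × ℝ × ℝ => clampedWeight w x z.1 z.2.1 z.2.2 *
      (clampedOpinion x z.1 z.2.2 - clampedOpinion x z.1 z.2.1) ^ 2 :=
    (measurable_clampedWeight hw hx).mul
      (((hy.comp (measurable_fst.prodMk measurable_snd.snd)).sub
      (hy.comp (measurable_fst.prodMk measurable_snd.fst))).pow_const 2)
  exact (h.stronglyMeasurable.integral_prod_right').measurable

/-- The total disagreement of a solution with symmetric weights is integrable in time. -/
theorem integrableOn_disagreement_clamped {W : ℝ} {w : ℝ → ℝ → ℝ → ℝ → ℝ → ℝ}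
    {x : ℝ → ℝ → ℝ} (hw : IsWeight W w) (hsym : SymmetricWeight w) (hx : IsSolution w x) :
    IntegrableOn (fun t => disagreement (volume.restrict (Icc (0:ℝ) 1))
      (clampedWeight w x t) (clampedOpinion x t)) (Ioi 0) := by
  have : IsProbabilityMeasure (volume.restrict (Icc (0:ℝ) 1)) := ⟨by simp⟩
  have hk0 := clampedWeight_nonneg (x := x) hw
  have hkW := clampedWeight_le (x := x) hw
  have hk := measurable_clampedWeight hw hx
  have hy := measurable_clampedOpinion hx
  have hD0 := fun t => disagreement_nonneg (ν := volume.restrict (Icc (0:ℝ) 1))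
    (u := clampedOpinion x t) (hk0 t)
  refine integrableOn_Ioi_of_intervalIntegral_norm_bounded 1 0 (b := fun n : ℕ => (n : ℝ))
    (l := atTop) (fun n => ?_) tendsto_natCast_atTop_atTop (Eventually.of_forall fun n => ?_)
  · obtain ⟨M, hM⟩ := exists_abs_clampedOpinion_le hx n.cast_nonneg
    refine Measure.integrableOn_of_bounded (M := W * (2 * M) * (2 * M)) (by simp)
      (measurable_disagreement_clamped hw hx).aestronglyMeasurable ?_
    filter_upwards [ae_restrict_mem measurableSet_Ioc] with t ht
    have hMt := hM t (Ioc_subset_Icc_self ht)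
    have := norm_integral_le_of_norm_le_const
      (μ := (volume.restrict (Icc (0:ℝ) 1)).prod (volume.restrict (Icc (0:ℝ) 1)))
      (C := W * (2 * M) * (2 * M))
      (f := fun p => clampedWeight w x t p.1 p.2 *
        (clampedOpinion x t p.2 - clampedOpinion x t p.1) ^ 2)
      (ae_of_all _ fun p => by
        have h1 := abs_kernel_mul_sub_le (hk0 t) (hkW t) hMt p.1 p.2
        have h2 := (abs_sub _ _).trans (add_le_add (hMt p.2) (hMt p.1))
        rw [Real.norm_eq_abs, pow_two, ← mul_assoc, abs_mul]
        exact mul_le_mul h1 (by linarith) (abs_nonneg _) ((abs_nonneg _).trans h1))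
    simpa [disagreement] using this
  · have hn : (0:ℝ) ≤ n := n.cast_nonneg
    obtain ⟨M, hM⟩ := exists_abs_clampedOpinion_le hx hn
    simp_rw [Real.norm_eq_abs, abs_of_nonneg (hD0 _)]
    rw [integral_disagreement_eq hn hk hy hk0 hkW (fun t a b => hsym _ _ _ _ _) hM
      (integral_two_mul_clampedOpinion_mul_field hx hn)]
    have h0 : ∫ α in Icc (0:ℝ) 1, clampedOpinion x 0 α ^ 2 ≤ 1 := by
      have hb : ∀ α, ‖clampedOpinion x 0 α ^ 2‖ ≤ 1 := fun α => by
        have h := hx.init_mem _ (projIcc (0:ℝ) 1 zero_le_one α).2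
        rw [clampedOpinion, max_self, Real.norm_eq_abs, abs_of_nonneg (sq_nonneg _)]
        exact pow_le_one₀ h.1 h.2
      have := norm_integral_le_of_norm_le_const (μ := volume.restrict (Icc (0:ℝ) 1))
        (ae_of_all _ hb)
      exact (le_abs_self _).trans (by simpa using this)
    have h1 : 0 ≤ ∫ α in Icc (0:ℝ) 1, clampedOpinion x n α ^ 2 :=
      integral_nonneg fun α => sq_nonneg _
    linarith

/-- Masses of separated but interacting regions are controlled by the disagreement. -/
theorem mul_mass_le_disagreement {W r Δ δ t : ℝ} {w : ℝ → ℝ → ℝ → ℝ → ℝ → ℝ} {x : ℝ → ℝ → ℝ}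
    (hw : IsWeight W w) (hΓ : InGamma r Δ w) (hx : IsSolution w x) (hδ : 0 ≤ δ)
    {I I' : Set ℝ} (hI : MeasurableSet I) (hI' : MeasurableSet I')
    (hsep : ∀ y ∈ I, ∀ y' ∈ I', δ ≤ |y - y'| ∧ |y - y'| ≤ r) (ht : 0 ≤ t) :
    Δ * δ ^ 2 * (volume.real {α ∈ Icc (0:ℝ) 1 | x t α ∈ I} *
      volume.real {α ∈ Icc (0:ℝ) 1 | x t α ∈ I'})
      ≤ disagreement (volume.restrict (Icc (0:ℝ) 1))
        (clampedWeight w x t) (clampedOpinion x t) := by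
  have : IsProbabilityMeasure (volume.restrict (Icc (0:ℝ) 1)) := ⟨by simp⟩
  obtain ⟨M, hM⟩ := exists_abs_clampedOpinion_le hx ht
  have hyt : Measurable (clampedOpinion x t) :=
    (measurable_clampedOpinion hx).comp measurable_prodMk_left
  have hset : ∀ J : Set ℝ, MeasurableSet J → volume.real {α ∈ Icc (0:ℝ) 1 | x t α ∈ J}
      = (volume.restrict (Icc (0:ℝ) 1)).real (clampedOpinion x t ⁻¹' J) := fun J hJ => by
    rw [measureReal_restrict_apply (hyt hJ)]
    congr 1
    ext α
    simp only [mem_ofPred_eq, mem_inter_iff, mem_preimage]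
    constructor
    · rintro ⟨h1, h2⟩
      exact ⟨by rwa [clampedOpinion_eq ht h1], h1⟩
    · rintro ⟨h1, h2⟩
      exact ⟨h2, by rwa [clampedOpinion_eq ht h2] at h1⟩
  have hkt : Measurable (Function.uncurry (clampedWeight w x t)) :=
    (measurable_clampedWeight hw hx).comp
      (measurable_const.prodMk (measurable_fst.prodMk measurable_snd))
  rw [hset I hI, hset I' hI']
  refine mul_measureReal_le_disagreement hkt
    hyt (clampedWeight_nonneg hw t) (clampedWeight_le hw t) (hM t ⟨ht, le_rfl⟩)
    (hyt hI) (hyt hI') fun α hα β hβ => ?_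
  obtain ⟨h1, h2⟩ := hsep _ hα _ hβ
  refine mul_le_mul (hΓ _ (le_max_right t 0) _ (projIcc _ _ _ α).2 _ (projIcc _ _ _ β).2 _ _ h2) ?_
    (by positivity) (clampedWeight_nonneg hw t α β)
  rw [← sq_abs (_ - _), abs_sub_comm]
  exact pow_le_pow_left₀ hδ h1 2

/-- Suppose the symmetric weight function belongs to `Γ(r,Δ)` and `x`
is a solution. If `I, I'` are intervals such that every point of `I` is at distance
between `δ > 0` and `r` from every point of `I'`, and `liminf_{t→∞} μ_t(I') > 0`, then
`∫_0^∞ μ_t(I) dt < ∞`. -/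
theorem finite_occupation_time_near_massive_interval
    (W r Δ : ℝ) (hW : 0 < W) (hr : 0 < r) (hΔ : 0 < Δ)
    (w : ℝ → ℝ → ℝ → ℝ → ℝ → ℝ) (x : ℝ → ℝ → ℝ)
    (hw : IsWeight W w) (hsym : SymmetricWeight w) (hΓ : InGamma r Δ w)
    (hx : IsSolution w x)
    (I I' : Set ℝ) (hI : I.OrdConnected) (hI' : I'.OrdConnected)
    (δ : ℝ) (hδ : 0 < δ)
    (hsep : ∀ y ∈ I, ∀ y' ∈ I', δ ≤ |y - y'| ∧ |y - y'| ≤ r)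
    (hliminf : 0 < Filter.liminf
      (fun t => volume {α ∈ Icc (0:ℝ) 1 | x t α ∈ I'}) atTop) :
    (∫⁻ t in Ici (0:ℝ), volume {α ∈ Icc (0:ℝ) 1 | x t α ∈ I}) < ⊤ := by
  have hbound : ∀ (t : ℝ) (J : Set ℝ), volume {α ∈ Icc (0:ℝ) 1 | x t α ∈ J} ≤ 1 :=
    fun t J => (measure_mono (sep_subset _ _)).trans (by simp)
  obtain ⟨c, hc0, hc⟩ := exists_between hliminf
  have hc' := (eventually_lt_of_lt_liminf hc).and (eventually_ge_atTop (0:ℝ))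
  obtain ⟨T, hT⟩ := eventually_atTop.1 hc'
  have hT0 : 0 ≤ T := (hT T le_rfl).2
  have hc1 : c < ⊤ := (hT T le_rfl).1.trans_le ((hbound T I').trans le_top)
  have hcpos : 0 < c.toReal := ENNReal.toReal_pos hc0.ne' hc1.ne
  set D : ℝ → ℝ := fun t => disagreement (volume.restrict (Icc (0:ℝ) 1))
    (clampedWeight w x t) (clampedOpinion x t) with hD
  have hDint : IntegrableOn D (Ioi 0) := integrableOn_disagreement_clamped hw hsym hx
  have hlate : ∀ t ∈ Ioi T, volume {α ∈ Icc (0:ℝ) 1 | x t α ∈ I}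
      ≤ ENNReal.ofReal (D t / (Δ * δ ^ 2 * c.toReal)) := fun t ht => by
    have hfin : ∀ J : Set ℝ, volume {α ∈ Icc (0:ℝ) 1 | x t α ∈ J} ≠ ⊤ :=
      fun J => ((hbound t J).trans_lt ENNReal.one_lt_top).ne
    obtain ⟨hmass, ht0⟩ := hT t (le_of_lt ht)
    have hmass' : c.toReal ≤ volume.real {α ∈ Icc (0:ℝ) 1 | x t α ∈ I'} :=
      ENNReal.toReal_mono (hfin I') hmass.le
    have key := mul_mass_le_disagreement hw hΓ hx hδ.le hI.measurableSet
      hI'.measurableSet hsep ht0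
    rw [← ENNReal.ofReal_toReal (hfin I)]
    refine ENNReal.ofReal_le_ofReal ((le_div_iff₀ (by positivity)).2 (le_trans ?_ key))
    rw [mul_comm, mul_assoc, mul_comm c.toReal]
    exact mul_le_mul_of_nonneg_left (mul_le_mul_of_nonneg_left hmass' measureReal_nonneg)
      (by positivity)
  rw [← Icc_union_Ioi_eq_Ici hT0]
  refine (lintegral_union_le _ _ _).trans_lt (ENNReal.add_lt_top.2 ⟨?_, ?_⟩)
  · refine (lintegral_mono fun t => hbound t I).trans_lt ?_
    simp
  · exact (setLIntegral_mono' measurableSet_Ioi hlate).trans_lt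
      ((hDint.mono_set (Ioi_subset_Ioi hT0)).div_const _).lintegral_lt_top
end

section
/- Let x : [0,∞) × [0,1] → [0,1] be a function, written x_t(α), that is Lebesgue measurable in α for each fixed t. Suppose the measures μ_t converge in distribution to some finite Borel measure μ_∞, and the order of x is preserved. Then lim_{t→∞} x_t(α) exists for Lebesgue-almost every α ∈ [0,1]. -/
open MeasureTheory Filter Set Topology

/-- A set of reals is null as soon as every closed interval with endpoints in it is null. -/
theorem measure_eq_zero_of_forall_Icc_eq_zero (m : Measure ℝ) (S : Set ℝ)
    (h : ∀ u ∈ S, ∀ v ∈ S, m (Icc u v) = 0) : m S = 0 := by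
  refine measure_null_of_locally_null S fun y hy => ?_
  obtain ⟨u, hu, hul⟩ : ∃ u ∈ S, ∀ᶠ z in 𝓝[S] y, u ≤ z := by
    by_cases hlt : ∃ u ∈ S, u < y
    · obtain ⟨u, hu, huy⟩ := hlt
      exact ⟨u, hu, mem_nhdsWithin_of_mem_nhds (Ici_mem_nhds huy)⟩
    · push Not at hlt
      exact ⟨y, hy, eventually_mem_nhdsWithin.mono hlt⟩
  obtain ⟨v, hv, hvr⟩ : ∃ v ∈ S, ∀ᶠ z in 𝓝[S] y, z ≤ v := by
    by_cases hlt : ∃ v ∈ S, y < v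
    · obtain ⟨v, hv, hyv⟩ := hlt
      exact ⟨v, hv, mem_nhdsWithin_of_mem_nhds (Iic_mem_nhds hyv)⟩
    · push Not at hlt
      exact ⟨y, hy, eventually_mem_nhdsWithin.mono hlt⟩
  exact ⟨Icc u v, hul.and hvr, h u hu v hv⟩

/-- The continuous function equal to `1` below `a`, to `0` above `b` and affine in between. -/
noncomputable def descendingRamp (a b : ℝ) : BoundedContinuousFunction ℝ ℝ :=
  BoundedContinuousFunction.ofNormedAddCommGroup (fun y => max 0 (min 1 ((b - y) / (b - a))))
    (by fun_prop) 1 fun y => by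
      rw [Real.norm_of_nonneg (le_max_left _ _)]
      exact max_le zero_le_one (min_le_left _ _)

theorem descendingRamp_nonneg (a b y : ℝ) : 0 ≤ descendingRamp a b y := le_max_left _ _

theorem descendingRamp_le_one (a b y : ℝ) : descendingRamp a b y ≤ 1 :=
  max_le zero_le_one (min_le_left _ _)

theorem descendingRamp_of_le {a b y : ℝ} (hab : a < b) (hy : y ≤ a) :
    descendingRamp a b y = 1 := by
  have h : 1 ≤ (b - y) / (b - a) := by
    rw [le_div_iff₀ (by linarith)]
    linarith
  change max 0 (min 1 ((b - y) / (b - a))) = 1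
  rw [min_eq_left h, max_eq_right zero_le_one]

theorem descendingRamp_of_ge {a b y : ℝ} (hab : a < b) (hy : b ≤ y) :
    descendingRamp a b y = 0 :=
  max_eq_left ((min_le_right _ _).trans
    (div_nonpos_of_nonpos_of_nonneg (by linarith) (by linarith)))

section Ramp

variable {Ω : Type*} [MeasurableSpace Ω] {μ : Measure Ω} [IsFiniteMeasure μ]
  {g : Ω → ℝ} {s : Set Ω} {a b : ℝ}

theorem integrable_descendingRamp_comp (hg : Measurable g) :
    Integrable (fun ω => descendingRamp a b (g ω)) μ :=
  Integrable.of_bound ((descendingRamp a b).continuous.measurable.comp hg).aestronglyMeasurable 1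
    (Eventually.of_forall fun ω => by
      rw [Real.norm_of_nonneg (descendingRamp_nonneg _ _ _)]
      exact descendingRamp_le_one _ _ _)

theorem measureReal_le_integral_descendingRamp (hg : Measurable g) (hs : MeasurableSet s)
    (hab : a < b) (h : ∀ᵐ ω ∂μ, ω ∈ s → g ω ≤ a) :
    μ.real s ≤ ∫ ω, descendingRamp a b (g ω) ∂μ := by
  rw [← integral_indicator_one hs]
  refine integral_mono_ae ((integrable_const (1 : ℝ)).indicator hs)
    (integrable_descendingRamp_comp hg) (h.mono fun ω hω => ?_)
  by_cases hmem : ω ∈ s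
  · simp [hmem, descendingRamp_of_le hab (hω hmem)]
  · simp [hmem, descendingRamp_nonneg]

theorem integral_descendingRamp_le_measureReal (hg : Measurable g) (hs : MeasurableSet s)
    (hab : a < b) (h : ∀ᵐ ω ∂μ, ω ∉ s → b ≤ g ω) :
    ∫ ω, descendingRamp a b (g ω) ∂μ ≤ μ.real s := by
  rw [← integral_indicator_one hs]
  refine integral_mono_ae (integrable_descendingRamp_comp hg)
    ((integrable_const (1 : ℝ)).indicator hs) (h.mono fun ω hω => ?_)
  by_cases hmem : ω ∈ s
  · simp [hmem, descendingRamp_le_one]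
  · simp [hmem, descendingRamp_of_ge hab (hω hmem)]

end Ramp

/-- Under order preservation and convergence of the integrals of the ramp between `a` and `b`,
almost no agent oscillates infinitely often across `[a, b]`. -/
theorem OrderPreserved.ae_not_frequently_oscillate {x : ℝ → ℝ → ℝ} (horder : OrderPreserved x)
    (hmeas : ∀ t, 0 ≤ t → Measurable (x t)) {a b c : ℝ} (hab : a < b)
    (hconv : Tendsto (fun t => ∫ y, descendingRamp a b y ∂(opinionMeasure x t)) atTop (𝓝 c)) :
    ∀ᵐ α ∂(volume.restrict (Icc (0:ℝ) 1)),
      ¬((∃ᶠ t in atTop, x t α < a) ∧ ∃ᶠ t in atTop, b < x t α) := by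
  set ν : Measure ℝ := volume.restrict (Icc (0:ℝ) 1)
  have hν : ∀ᵐ α ∂ν, α ∈ Icc (0:ℝ) 1 := ae_restrict_mem measurableSet_Icc
  have h0 : Measurable (x 0) := hmeas 0 le_rfl
  have hintegral : ∀ t, 0 ≤ t → ∫ y, descendingRamp a b y ∂(opinionMeasure x t)
      = ∫ β, descendingRamp a b (x t β) ∂ν := fun t ht =>
    integral_map (hmeas t ht).aemeasurable (descendingRamp a b).continuous.aestronglyMeasurable
  have hlow : ∀ α ∈ Icc (0:ℝ) 1, (∃ᶠ t in atTop, x t α < a) →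
      ν.real {β | x 0 β ≤ x 0 α} ≤ c := by
    intro α hα hfreq
    refine ge_of_tendsto_of_frequently hconv ((hfreq.and_eventually (eventually_ge_atTop 0)).mono ?_)
    rintro t ⟨hlt, ht⟩
    rw [hintegral t ht]
    refine measureReal_le_integral_descendingRamp (hmeas t ht)
      (measurableSet_le h0 measurable_const) hab (hν.mono fun β hβ hle => ?_)
    refine le_trans (not_lt.1 fun hlt' => ?_) hlt.le
    exact absurd (horder α hα β hβ 0 le_rfl t ht hlt') (not_lt.2 hle)
  have hhigh : ∀ α ∈ Icc (0:ℝ) 1, (∃ᶠ t in atTop, b < x t α) →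
      c ≤ ν.real {β | x 0 β < x 0 α} := by
    intro α hα hfreq
    refine le_of_tendsto_of_frequently hconv ((hfreq.and_eventually (eventually_ge_atTop 0)).mono ?_)
    rintro t ⟨hlt, ht⟩
    rw [hintegral t ht]
    refine integral_descendingRamp_le_measureReal (hmeas t ht)
      (measurableSet_lt h0 measurable_const) hab (hν.mono fun β hβ hnot => ?_)
    refine hlt.le.trans (not_lt.1 fun hlt' => ?_)
    exact hnot (horder β hβ α hα 0 le_rfl t ht hlt')
  set I : Set ℝ := {α | α ∈ Icc (0:ℝ) 1 ∧
    (∃ᶠ t in atTop, x t α < a) ∧ ∃ᶠ t in atTop, b < x t α}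
  have hnull : (ν.map (x 0)) (x 0 '' I) = 0 := by
    refine measure_eq_zero_of_forall_Icc_eq_zero _ _ ?_
    rintro _ ⟨α, ⟨hα, -, hα_high⟩, rfl⟩ _ ⟨β, ⟨hβ, hβ_low, -⟩, rfl⟩
    rw [Measure.map_apply h0 measurableSet_Icc, ← measureReal_eq_zero_iff]
    have hsub : x 0 ⁻¹' Icc (x 0 α) (x 0 β) = {γ | x 0 γ ≤ x 0 β} \ {γ | x 0 γ < x 0 α} := by
      ext γ
      simp [and_comm]
    rcases lt_or_ge (x 0 β) (x 0 α) with hlt | hle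
    · simp [Icc_eq_empty (not_le.2 hlt)]
    · have hincl : {γ | x 0 γ < x 0 α} ⊆ {γ | x 0 γ ≤ x 0 β} :=
        fun γ (hγ : x 0 γ < x 0 α) => hγ.le.trans hle
      rw [hsub, measureReal_sdiff hincl (measurableSet_lt h0 measurable_const)]
      exact le_antisymm (by linarith [hlow β hβ hβ_low, hhigh α hα hα_high])
        (sub_nonneg.2 (measureReal_mono hincl))
  have hI : ∀ᵐ α ∂ν, α ∉ I := by
    refine measure_mono_null (fun α hα => ?_)
      (Measure.preimage_null_of_map_null h0.aemeasurable hnull)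
    exact mem_image_of_mem _ (not_not.1 hα)
  filter_upwards [hν, hI] with α hα hαI hosc
  exact hαI ⟨hα, hosc⟩

/-- Let `x_t(α) ∈ [0,1]` be measurable in `α` for each `t ≥ 0`.
If the opinion distributions converge in distribution to some finite Borel measure and
the order of `x` is preserved, then `lim_{t→∞} x_t(α)` exists for almost every
`α ∈ [0,1]`. -/
theorem order_preservation_and_distribution_convergence_imply_ae_convergence
    (x : ℝ → ℝ → ℝ)
    (hmem : ∀ t, 0 ≤ t → ∀ α ∈ Icc (0:ℝ) 1, x t α ∈ Icc (0:ℝ) 1)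
    (hmeas : ∀ t, 0 ≤ t → Measurable (x t))
    (μlim : Measure ℝ) (hfin : IsFiniteMeasure μlim)
    (hconv : ∀ η : BoundedContinuousFunction ℝ ℝ,
      Tendsto (fun t => ∫ y, η y ∂(opinionMeasure x t)) atTop
        (𝓝 (∫ y, η y ∂μlim)))
    (horder : OrderPreserved x) :
    ∀ᵐ α ∂(volume.restrict (Icc (0:ℝ) 1)),
      ∃ l : ℝ, Tendsto (fun t => x t α) atTop (𝓝 l) := by
  have hosc : ∀ᵐ α ∂(volume.restrict (Icc (0:ℝ) 1)), ∀ a b : ℚ, a < b →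
      ¬((∃ᶠ t in atTop, x t α < a) ∧ ∃ᶠ t in atTop, b < x t α) := by
    simp only [ae_all_iff]
    exact fun a b hab => horder.ae_not_frequently_oscillate hmeas (Rat.cast_lt.2 hab) (hconv _)
  filter_upwards [ae_restrict_mem measurableSet_Icc, hosc] with α hα hosc
  have hbdd : ∀ᶠ t in atTop, x t α ∈ Icc (0:ℝ) 1 :=
    (eventually_ge_atTop 0).mono fun t ht => hmem t ht α hα
  refine tendsto_of_no_upcrossings Rat.denseRange_cast ?_
    (isBoundedUnder_of_eventually_le (hbdd.mono fun t ht => ht.2))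
    (isBoundedUnder_of_eventually_ge (hbdd.mono fun t ht => ht.1))
  rintro _ ⟨a, rfl⟩ _ ⟨b, rfl⟩ hab
  exact hosc a b (Rat.cast_lt.1 hab)
end

section
/- Suppose the weight function w depends only on time and the two opinion values, i.e. w(t,α,β,a,b) = w̃(t,a,b) for a function w̃ : [0,∞) × ℝ × ℝ → ℝ that is nonnegative, bounded by W, symmetric in its last two arguments (w̃(t,a,b) = w̃(t,b,a)), and Lipschitz continuous in the sense that |w̃(t,x,y) − w̃(t,x,z)| ≤ L·|y − z| for all t, x, y, z and some constant L. Then for any solution x of the opinion dynamics, the order of x is preserved. -/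
open MeasureTheory Filter Set Topology

theorem AbsolutelyContinuousOnInterval.le_of_ae_deriv_nonneg {f : ℝ → ℝ} {a b : ℝ}
    (hab : a ≤ b) (hf : AbsolutelyContinuousOnInterval f a b)
    (hderiv : ∀ᵐ t, t ∈ Icc a b → 0 ≤ deriv f t) : f a ≤ f b := by
  have h : 0 ≤ ∫ t in a..b, deriv f t :=
    intervalIntegral.integral_nonneg_of_ae_restrict hab
      ((ae_restrict_iff' measurableSet_Icc).mpr hderiv)
  rw [hf.integral_deriv_eq_sub] at h
  linarith

theorem absolutelyContinuousOnInterval_exp_const_mul (c a b : ℝ) :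
    AbsolutelyContinuousOnInterval (fun t => Real.exp (c * t)) a b :=
  ContDiffOn.absolutelyContinuousOnInterval
    (by fun_prop : ContDiff ℝ 1 fun t => Real.exp (c * t)).contDiffOn

/-- Monotonicity behind Grönwall's inequality, forwards for `σ = 1` and backwards for
`σ = -1`. -/
theorem AbsolutelyContinuousOnInterval.exp_mul_sq_le {D d : ℝ → ℝ} {a b K σ : ℝ}
    (hσ : σ = 1 ∨ σ = -1) (hab : a ≤ b) (hD : AbsolutelyContinuousOnInterval D a b)
    (hd : ∀ᵐ t, t ∈ Icc a b → HasDerivAt D (d t) t ∧ |d t| ≤ K * |D t|) :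
    σ * (Real.exp (2 * K * σ * a) * (D a * D a)) ≤
      σ * (Real.exp (2 * K * σ * b) * (D b * D b)) := by
  refine AbsolutelyContinuousOnInterval.le_of_ae_deriv_nonneg
    (f := fun t => σ * (Real.exp (2 * K * σ * t) * (D t * D t))) hab
    (((absolutelyContinuousOnInterval_exp_const_mul _ a b).fun_mul
      (hD.fun_mul hD)).const_mul σ) ?_
  filter_upwards [hd] with t ht hmem
  obtain ⟨hder, hle⟩ := ht hmem
  have hexp : HasDerivAt (fun t => Real.exp (2 * K * σ * t))
      (Real.exp (2 * K * σ * t) * (2 * K * σ * 1)) t :=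
    ((hasDerivAt_id t).const_mul (2 * K * σ)).exp
  have hderiv := ((hexp.fun_mul (hder.fun_mul hder)).const_mul σ).deriv
  rw [hderiv]
  have hprod : |D t * d t| ≤ K * (D t * D t) := by
    rw [abs_mul, ← abs_mul_abs_self (D t)]
    nlinarith [abs_nonneg (D t)]
  obtain ⟨h₁, h₂⟩ := abs_le.mp hprod
  have hpos := Real.exp_pos (2 * K * σ * t)
  rcases hσ with rfl | rfl
  · have := mul_nonneg hpos.le (by linarith : 0 ≤ K * (D t * D t) + D t * d t)
    linarith
  · have := mul_nonneg hpos.le (by linarith : 0 ≤ K * (D t * D t) - D t * d t)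
    linarith

theorem AbsolutelyContinuousOnInterval.ne_zero_of_ae_abs_deriv_le {D d : ℝ → ℝ} {a b K : ℝ}
    (hab : a ≤ b) (hD : AbsolutelyContinuousOnInterval D a b)
    (hd : ∀ᵐ t, t ∈ Icc a b → HasDerivAt D (d t) t ∧ |d t| ≤ K * |D t|)
    {s t : ℝ} (hs : s ∈ Icc a b) (ht : t ∈ Icc a b) (hDt : D t ≠ 0) : D s ≠ 0 := by
  intro hDs
  have hpos : 0 < D t * D t := mul_self_pos.mpr hDt
  have hsub : ∀ {u v : ℝ}, u ∈ Icc a b → v ∈ Icc a b → u ≤ v →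
      AbsolutelyContinuousOnInterval D u v ∧
      ∀ᵐ r, r ∈ Icc u v → HasDerivAt D (d r) r ∧ |d r| ≤ K * |D r| := by
    intro u v hu hv huv
    refine ⟨hD.mono ?_, ?_⟩
    · rw [uIcc_of_le huv, uIcc_of_le hab]
      exact Icc_subset_Icc hu.1 hv.2
    · filter_upwards [hd] with r hr hmem
      exact hr (Icc_subset_Icc hu.1 hv.2 hmem)
  rcases le_total s t with hst | hts
  · obtain ⟨h₁, h₂⟩ := hsub hs ht hst
    have := h₁.exp_mul_sq_le (.inr rfl) hst h₂
    rw [hDs] at this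
    nlinarith [mul_pos (Real.exp_pos (2 * K * (-1) * t)) hpos]
  · obtain ⟨h₁, h₂⟩ := hsub ht hs hts
    have := h₁.exp_mul_sq_le (.inl rfl) hts h₂
    rw [hDs] at this
    nlinarith [mul_pos (Real.exp_pos (2 * K * 1 * t)) hpos]

theorem AbsolutelyContinuousOnInterval.pos_of_ae_abs_deriv_le {D d : ℝ → ℝ} {a b K : ℝ}
    (hab : a ≤ b) (hD : AbsolutelyContinuousOnInterval D a b)
    (hd : ∀ᵐ t, t ∈ Icc a b → HasDerivAt D (d t) t ∧ |d t| ≤ K * |D t|)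
    {s t : ℝ} (hs : s ∈ Icc a b) (ht : t ∈ Icc a b) (hDt : 0 < D t) : 0 < D s := by
  by_contra! hDs
  have hcont : ContinuousOn D (Icc a b) := uIcc_of_le hab ▸ hD.continuousOn
  obtain ⟨r, hr, hr0⟩ := isPreconnected_Icc.intermediate_value hs ht hcont ⟨hDs, hDt.le⟩
  exact hD.ne_zero_of_ae_abs_deriv_le hab hd hr ht hDt.ne' hr0

theorem abs_weighted_difference_sub_le {φ : ℝ → ℝ → ℝ} {W L M a b y : ℝ} (hL : 0 ≤ L)
    (hnonneg : 0 ≤ φ b y) (hbdd : φ b y ≤ W)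
    (hlip : |φ b y - φ a y| ≤ L * |b - a|) (ha : |a| ≤ M) (hy : |y| ≤ M) :
    |φ b y * (y - b) - φ a y * (y - a)| ≤ (2 * M * L + W) * |b - a| := by
  have hya : |y - a| ≤ 2 * M := by linarith [abs_sub y a]
  calc |φ b y * (y - b) - φ a y * (y - a)|
      = |(φ b y - φ a y) * (y - a) - φ b y * (b - a)| := by ring_nf
    _ ≤ |φ b y - φ a y| * |y - a| + φ b y * |b - a| := by
      refine (abs_sub _ _).trans_eq ?_
      rw [abs_mul, abs_mul, abs_of_nonneg hnonneg]
    _ ≤ L * |b - a| * (2 * M) + W * |b - a| := by gcongr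
    _ = (2 * M * L + W) * |b - a| := by ring

/-- If the weights depend only on time and the two opinion values via
a nonnegative, bounded, symmetric function `w̃` that is Lipschitz in its last argument,
then for any solution of the opinion dynamics the order of the opinions is preserved. -/
theorem lipschitz_opinion_weights_preserve_order
    (W L : ℝ) (hW : 0 < W) (wt : ℝ → ℝ → ℝ → ℝ)
    (hmeas : Measurable fun p : ℝ × ℝ × ℝ => wt p.1 p.2.1 p.2.2)
    (hnonneg : ∀ t, 0 ≤ t → ∀ a b : ℝ, 0 ≤ wt t a b)
    (hbdd : ∀ t, 0 ≤ t → ∀ a b : ℝ, wt t a b ≤ W)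
    (hsymm : ∀ t a b : ℝ, wt t a b = wt t b a)
    (hlip : ∀ t u y z : ℝ, |wt t u y - wt t u z| ≤ L * |y - z|)
    (x : ℝ → ℝ → ℝ)
    (hx : IsSolution (fun t _ _ a b => wt t a b) x) :
    OrderPreserved x := by
  intro α hα β hβ s hs t ht hlt
  have hL : 0 ≤ L := by simpa using (abs_nonneg _).trans (hlip 0 0 1 0)
  set T := max s t
  have hT : 0 ≤ T := hs.trans (le_max_left s t)
  obtain ⟨M, hM⟩ := hx.locBdd T hT
  have hint : ∀ r ∈ Icc 0 T, ∀ γ ∈ Icc (0:ℝ) 1, IntervalIntegrable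
      (fun η => wt r (x r γ) (x r η) * (x r η - x r γ)) volume 0 1 := by
    intro r hr γ hγ
    have hxm := hx.meas r hr.1
    rw [intervalIntegrable_iff_integrableOn_Ioc_of_le zero_le_one]
    refine Measure.integrableOn_of_bounded (M := W * (2 * M)) (by simp)
      ((hmeas.comp (by fun_prop : Measurable fun η => (r, x r γ, x r η))).mul
        (hxm.sub_const _)).aestronglyMeasurable ?_
    refine (ae_restrict_iff' measurableSet_Ioc).mpr (ae_of_all _ fun η hη => ?_)
    rw [Real.norm_eq_abs, abs_mul, abs_of_nonneg (hnonneg r hr.1 _ _)]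
    refine mul_le_mul (hbdd r hr.1 _ _) ?_ (abs_nonneg _) hW.le
    linarith [abs_sub (x r η) (x r γ), hM η (Ioc_subset_Icc_self hη) r hr, hM γ hγ r hr]
  have hac : ∀ γ ∈ Icc (0:ℝ) 1, AbsolutelyContinuousOnInterval (fun r => x r γ) 0 T :=
    fun γ hγ => (hx.absCont γ hγ T hT).absolutelyContinuousOnInterval hT
  have hode : ∀ᵐ r, r ∈ Icc 0 T →
      HasDerivAt (fun r => x r β - x r α)
        (interactionField (fun t _ _ a b => wt t a b) x r β -
          interactionField (fun t _ _ a b => wt t a b) x r α) r ∧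
      |interactionField (fun t _ _ a b => wt t a b) x r β -
          interactionField (fun t _ _ a b => wt t a b) x r α| ≤
        (2 * M * L + W) * |x r β - x r α| := by
    filter_upwards [(ae_restrict_iff' measurableSet_Ici).mp (hx.ode α hα),
      (ae_restrict_iff' measurableSet_Ici).mp (hx.ode β hβ)] with r hrα hrβ hr
    refine ⟨(hrβ hr.1).sub (hrα hr.1), ?_⟩
    rw [interactionField, interactionField,
      ← intervalIntegral.integral_sub (hint r hr β hβ) (hint r hr α hα), ← Real.norm_eq_abs]
    refine (intervalIntegral.norm_integral_le_of_norm_le_const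
      (C := (2 * M * L + W) * |x r β - x r α|) fun η hη => ?_).trans_eq (by simp)
    rw [uIoc_of_le zero_le_one] at hη
    refine abs_weighted_difference_sub_le hL (hnonneg r hr.1 _ _) (hbdd r hr.1 _ _) ?_
      (hM α hα r hr) (hM η (Ioc_subset_Icc_self hη) r hr)
    rw [hsymm r (x r β), hsymm r (x r α)]
    exact hlip r _ _ _
  have := ((hac β hβ).fun_sub (hac α hα)).pos_of_ae_abs_deriv_le hT hode
    ⟨hs, le_max_left s t⟩ ⟨ht, le_max_right s t⟩ (sub_pos.mpr hlt)
  exact sub_pos.mp this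
end
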